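/- arXiv:2309.09910 — 13 statements merged into one kernel-verified Lean document; each statement's English description precedes it below -/
import Mathlib

section
/- For any linear orders L and L', the linear order ζL (that is, ℤ·L, the lexicographic order on L × ℤ comparing the L-coordinate first) is order-isomorphic to ζL' if and only if L is order-isomorphic to L'. -/
namespace ZetaMul

variable {L L' : Type*} [LinearOrder L] [LinearOrder L']

/-- In `L ×ₗ ℤ`, a covering pair lies in a single copy of `ℤ`. -/
theorem fst_eq_of_covBy {x y : L ×ₗ ℤ} (h : x ⋖ y) : (ofLex x).1 = (ofLex y).1 := by
  rcases Prod.Lex.covBy_iff.1 h with h | ⟨-, h, -⟩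
  · exact h.1
  · exact absurd h (not_isMax _)

/-- An order isomorphism maps each copy of `ℤ` into a single copy of `ℤ`. -/
theorem fst_apply_toLex (e : (L ×ₗ ℤ) ≃o (L' ×ₗ ℤ)) (a : L) (n : ℤ) :
    (ofLex (e (toLex (a, n)))).1 = (ofLex (e (toLex (a, 0)))).1 := by
  have step (m : ℤ) :
      (ofLex (e (toLex (a, m)))).1 = (ofLex (e (toLex (a, m + 1)))).1 :=
    fst_eq_of_covBy <| (apply_covBy_apply_iff e).2 <|
      Prod.Lex.toLex_covBy_toLex_iff.2 (.inl ⟨rfl, Order.covBy_add_one m⟩)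
  induction n with
  | zero => rfl
  | succ k ih => exact (step k).symm.trans ih
  | pred k ih => exact (step (-k - 1)).trans (by rwa [sub_add_cancel])

/-- The map on indices of copies of `ℤ` induced by an order isomorphism. -/
def indexMap (e : (L ×ₗ ℤ) ≃o (L' ×ₗ ℤ)) (a : L) : L' :=
  (ofLex (e (toLex (a, 0)))).1

theorem indexMap_monotone (e : (L ×ₗ ℤ) ≃o (L' ×ₗ ℤ)) : Monotone (indexMap e) :=
  fun _ _ h => Prod.Lex.monotone_fst _ _ <|
    e.monotone (Prod.Lex.toLex_mono (Prod.mk_le_mk.2 ⟨h, le_rfl⟩))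

theorem indexMap_symm_indexMap (e : (L ×ₗ ℤ) ≃o (L' ×ₗ ℤ)) (a : L) :
    indexMap e.symm (indexMap e a) = a := by
  have h := fst_apply_toLex e.symm (indexMap e a) (ofLex (e (toLex (a, 0)))).2
  have h' : toLex (indexMap e a, (ofLex (e (toLex (a, 0)))).2) = e (toLex (a, 0)) := rfl
  rw [h', e.symm_apply_apply] at h
  exact h.symm

/-- The order isomorphism on indices induced by an order isomorphism of `ζ`-multiples. -/
def indexIso (e : (L ×ₗ ℤ) ≃o (L' ×ₗ ℤ)) : L ≃o L' :=
  Equiv.toOrderIso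
    { toFun := indexMap e
      invFun := indexMap e.symm
      left_inv := indexMap_symm_indexMap e
      right_inv := indexMap_symm_indexMap e.symm }
    (indexMap_monotone e) (indexMap_monotone e.symm)

end ZetaMul

/-- For a linear order `L`, `ζL` is the lexicographic order on `L × ℤ`
(`L`-coordinate first), i.e. `Lex (L × ℤ)`, written `L ×ₗ ℤ`.  The theorem:
`ζL ≅ ζL'` iff `L ≅ L'`. -/
theorem zetaMul_orderIso_iff (L L' : Type*) [LinearOrder L] [LinearOrder L'] :
    Nonempty ((L ×ₗ ℤ) ≃o (L' ×ₗ ℤ)) ↔ Nonempty (L ≃o L') :=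
  ⟨fun ⟨e⟩ => ⟨ZetaMul.indexIso e⟩,
    fun ⟨f⟩ => ⟨Prod.Lex.prodLexCongr f (OrderIso.refl ℤ)⟩⟩
end

section
/- The quasi-order of convex embeddability on linear orders with domain ℕ has chains of order type (ℝ, <) and antichains of size continuum: (1) there is a family (L_x)_{x ∈ ℝ} of linear orders on ℕ such that for all x < y, L_x convexly embeds into L_y but L_y does not convexly embed into L_x; (2) there is a family (M_x)_{x ∈ ℝ} of linear orders on ℕ such that for all distinct x, y, neither M_x convexly embeds into M_y nor M_y into M_x. -/
/-- `L` convexly embeds into `L'` (`L ⊴ L'`): there is an order embedding of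
`L` into `L'` (here both are linear orders on `ℕ`) whose range is convex. -/
def CvxEmb (L L' : LinearOrder ℕ) : Prop :=
  ∃ f : ℕ → ℕ, (∀ a b : ℕ, L.le a b ↔ L'.le (f a) (f b)) ∧
    ∀ x y z : ℕ, L'.le x y → L'.le y z →
      x ∈ Set.range f → z ∈ Set.range f → y ∈ Set.range f

/-- The sum over `q ∈ S`, in the order of `ℚ`, of finite chains with `Encodable.encode q + 1`
elements; distinct rationals thus carry chains of distinct lengths. -/
abbrev ChainSum (S : Set ℚ) : Type :=
  {p : ℚ ×ₗ ℕ // (ofLex p).1 ∈ S ∧ (ofLex p).2 ≤ Encodable.encode (ofLex p).1}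

namespace ChainSum

variable {S T : Set ℚ}

/-- The `k`-th element of the chain at `q`. -/
abbrev mk (q : ℚ) (k : ℕ) (hq : q ∈ S) (hk : k ≤ Encodable.encode q) : ChainSum S :=
  ⟨toLex (q, k), hq, hk⟩

theorem mk_lt_mk {q r : ℚ} {k l : ℕ} {hq : q ∈ S} {hk : k ≤ Encodable.encode q}
    {hr : r ∈ S} {hl : l ≤ Encodable.encode r} :
    mk q k hq hk < mk r l hr hl ↔ q < r ∨ q = r ∧ k < l := by
  rw [Subtype.mk_lt_mk, Prod.Lex.toLex_lt_toLex]

theorem exists_eq_mk (a : ChainSum S) : ∃ q k hq hk, a = mk q k hq hk :=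
  ⟨(ofLex a.1).1, (ofLex a.1).2, a.2.1, a.2.2, rfl⟩

theorem mk_covBy_mk_succ {q : ℚ} {k : ℕ} (hq : q ∈ S) (hk : k + 1 ≤ Encodable.encode q) :
    mk q k hq (by omega) ⋖ mk q (k + 1) hq hk := by
  refine ⟨mk_lt_mk.2 (Or.inr ⟨rfl, by omega⟩), fun c h₁ h₂ => ?_⟩
  obtain ⟨r, l, hr, hl, rfl⟩ := c.exists_eq_mk
  rw [mk_lt_mk] at h₁ h₂
  rcases h₁ with h₁ | ⟨rfl, h₁⟩
  · rcases h₂ with h₂ | ⟨rfl, h₂⟩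
    · exact lt_asymm h₁ h₂
    · exact lt_irrefl _ h₁
  · rcases h₂ with h₂ | ⟨-, h₂⟩
    · exact lt_irrefl _ h₂
    · omega

theorem eq_and_eq_succ_of_covBy [hS : S.OrdConnected] {q r : ℚ} {k l : ℕ} {hq : q ∈ S}
    {hk : k ≤ Encodable.encode q} {hr : r ∈ S} {hl : l ≤ Encodable.encode r}
    (h : mk q k hq hk ⋖ mk r l hr hl) : r = q ∧ l = k + 1 := by
  rcases mk_lt_mk.1 h.1 with hlt | ⟨rfl, hlt⟩
  · obtain ⟨m, hm₁, hm₂⟩ := exists_between hlt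
    exact (h.2 (c := mk m 0 (hS.out hq hr ⟨hm₁.le, hm₂.le⟩) (Nat.zero_le _))
      (mk_lt_mk.2 (Or.inl hm₁)) (mk_lt_mk.2 (Or.inl hm₂))).elim
  · refine ⟨rfl, ?_⟩
    by_contra hne
    exact h.2 (c := mk q (k + 1) hq (by omega))
      (mk_lt_mk.2 (Or.inr ⟨rfl, by omega⟩)) (mk_lt_mk.2 (Or.inr ⟨rfl, by omega⟩))

instance [NoMinOrder S] : NoMinOrder (ChainSum S) where
  exists_lt a := by
    obtain ⟨q, k, hq, hk, rfl⟩ := a.exists_eq_mk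
    obtain ⟨r, hr⟩ := exists_lt (⟨q, hq⟩ : S)
    exact ⟨mk r 0 r.2 (Nat.zero_le _), mk_lt_mk.2 (Or.inl hr)⟩

instance [NoMaxOrder S] : NoMaxOrder (ChainSum S) where
  exists_gt a := by
    obtain ⟨q, k, hq, hk, rfl⟩ := a.exists_eq_mk
    obtain ⟨r, hr⟩ := exists_gt (⟨q, hq⟩ : S)
    exact ⟨mk r 0 r.2 (Nat.zero_le _), mk_lt_mk.2 (Or.inl hr)⟩

instance [h : Nonempty S] : Nonempty (ChainSum S) :=
  h.map fun q : S => mk q.1 0 q.2 (Nat.zero_le _)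

instance : Countable (ChainSum S) :=
  inferInstanceAs (Countable {p : ℚ × ℕ // p.1 ∈ S ∧ p.2 ≤ Encodable.encode p.1})

theorem subset_of_convex_embedding [S.OrdConnected] [T.OrdConnected] [NoMinOrder S] [NoMaxOrder S]
    (f : ChainSum S ↪o ChainSum T) (hf : (Set.range f).OrdConnected) : S ⊆ T := by
  have hcov {a b : ChainSum S} : f a ⋖ f b ↔ a ⋖ b := hf.apply_covBy_apply_iff f
  intro q hq
  obtain ⟨r, j, hr, hj, h₀⟩ := (f (mk q 0 hq (Nat.zero_le _))).exists_eq_mk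
  have hj₀ : j = 0 := by
    by_contra hne
    obtain ⟨i, rfl⟩ := Nat.exists_eq_succ_of_ne_zero hne
    have hi := mk_covBy_mk_succ hr hj
    rw [← h₀] at hi
    obtain ⟨a, ha⟩ := exists_lt (mk q 0 hq (Nat.zero_le _))
    obtain ⟨b, hb⟩ := hf.out ⟨a, rfl⟩ ⟨_, rfl⟩ ⟨hi.le_of_lt (f.lt_iff_lt.2 ha), hi.le⟩
    rw [← hb, hcov] at hi
    obtain ⟨s, l, hs, hl, rfl⟩ := b.exists_eq_mk
    have := (eq_and_eq_succ_of_covBy hi).2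
    omega
  subst hj₀
  have hstep (k : ℕ) (hk : k ≤ Encodable.encode q) :
      ∃ hk' : k ≤ Encodable.encode r, f (mk q k hq hk) = mk r k hr hk' := by
    induction k with
    | zero => exact ⟨hj, h₀⟩
    | succ k ih =>
      obtain ⟨hk', hfk⟩ := ih (by omega)
      have h := hcov.2 (mk_covBy_mk_succ hq hk)
      obtain ⟨s, l, hs, hl, hfs⟩ := (f (mk q (k + 1) hq hk)).exists_eq_mk
      rw [hfk, hfs] at h
      obtain ⟨rfl, rfl⟩ := eq_and_eq_succ_of_covBy h
      exact ⟨hl, hfs⟩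
  obtain ⟨hle, htop⟩ := hstep _ le_rfl
  rcases hle.eq_or_lt with heq | hlt
  · rwa [Encodable.encode_injective heq]
  · have hi := mk_covBy_mk_succ hr hlt
    rw [← htop] at hi
    obtain ⟨a, ha⟩ := exists_gt (mk q (Encodable.encode q) hq le_rfl)
    obtain ⟨b, hb⟩ := hf.out ⟨_, rfl⟩ ⟨a, rfl⟩ ⟨hi.le, hi.ge_of_gt (f.lt_iff_lt.2 ha)⟩
    rw [← hb, hcov] at hi
    obtain ⟨s, l, hs, hl, rfl⟩ := b.exists_eq_mk
    obtain ⟨rfl, rfl⟩ := eq_and_eq_succ_of_covBy hi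
    omega

theorem exists_convex_embedding [hS : S.OrdConnected] (h : S ⊆ T) :
    ∃ f : ChainSum S ↪o ChainSum T, (Set.range f).OrdConnected := by
  refine ⟨⟨⟨fun a => ⟨a.1, h a.2.1, a.2.2⟩, fun a b hab => Subtype.ext (congrArg (·.1) hab)⟩,
    Iff.rfl⟩, ⟨?_⟩⟩
  rintro _ ⟨a, rfl⟩ _ ⟨b, rfl⟩ c ⟨hac, hcb⟩
  exact ⟨⟨c.1, hS.out a.2.1 b.2.1
    ⟨Prod.Lex.monotone_fst_ofLex hac, Prod.Lex.monotone_fst_ofLex hcb⟩, c.2.2⟩, rfl⟩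

end ChainSum

theorem cvxEmb_lift_iff {α β : Type*} [iα : LinearOrder α] [iβ : LinearOrder β]
    (e : ℕ ≃ α) (e' : ℕ ≃ β) :
    CvxEmb (LinearOrder.lift' e e.injective) (LinearOrder.lift' e' e'.injective) ↔
      ∃ f : α ↪o β, (Set.range f).OrdConnected := by
  constructor
  · rintro ⟨f, hle, hconv⟩
    refine ⟨OrderEmbedding.ofMapLEIff (fun a => e' (f (e.symm a))) fun a b => ?_, ⟨?_⟩⟩
    · have := hle (e.symm a) (e.symm b)
      change e _ ≤ e _ ↔ e' _ ≤ e' _ at this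
      simpa using this.symm
    · rintro _ ⟨a, rfl⟩ _ ⟨b, rfl⟩ c ⟨hac, hcb⟩
      have hc : e' (e'.symm c) = c := e'.apply_symm_apply c
      obtain ⟨n, hn⟩ := hconv (f (e.symm a)) (e'.symm c) (f (e.symm b))
        (show e' _ ≤ e' _ from hc.symm ▸ hac) (show e' _ ≤ e' _ from hc.symm ▸ hcb)
        ⟨_, rfl⟩ ⟨_, rfl⟩
      exact ⟨e n, by simp [hn]⟩
  · rintro ⟨f, hf⟩
    refine ⟨fun n => e'.symm (f (e n)), fun a b => ?_, ?_⟩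
    · change e _ ≤ e _ ↔ e' _ ≤ e' _
      simp
    · rintro _ y _ hxy hyz ⟨a, rfl⟩ ⟨b, rfl⟩
      change e' _ ≤ e' _ at hxy hyz
      rw [Equiv.apply_symm_apply] at hxy hyz
      obtain ⟨c, hc⟩ := hf.out ⟨_, rfl⟩ ⟨_, rfl⟩ ⟨hxy, hyz⟩
      exact ⟨e.symm c, by simp [hc]⟩

/-- Inclusion between rational traces of nonempty open convex sets of reals is realized by convex
embeddability of linear orders on `ℕ`. -/
theorem exists_cvxEmb_iff_preimage_subset {ι : Type*} (U : ι → Set ℝ) (hopen : ∀ i, IsOpen (U i))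
    (hne : ∀ i, (U i).Nonempty) (hconv : ∀ i, (U i).OrdConnected) :
    ∃ L : ι → LinearOrder ℕ, ∀ i j, CvxEmb (L i) (L j) ↔
      ((↑) ⁻¹' U i : Set ℚ) ⊆ (↑) ⁻¹' U j := by
  have hc (i : ι) : ((↑) ⁻¹' U i : Set ℚ).OrdConnected :=
    (hconv i).preimage_mono Rat.cast_mono
  have hN (i : ι) : Nonempty ((↑) ⁻¹' U i : Set ℚ) := by
    obtain ⟨q, hq⟩ := Rat.denseRange_cast.exists_mem_open (hopen i) (hne i)
    exact ⟨q, hq⟩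
  have hopen' (i : ι) : IsOpen ((↑) ⁻¹' U i : Set ℚ) := (hopen i).preimage Rat.continuous_coe_real
  have hmin (i : ι) : NoMinOrder ((↑) ⁻¹' U i : Set ℚ) := ⟨fun a => by
    obtain ⟨l, hl, hs⟩ := exists_Ioc_subset_of_mem_nhds ((hopen' i).mem_nhds a.2) (exists_lt a.1)
    obtain ⟨m, hm₁, hm₂⟩ := exists_between hl
    exact ⟨⟨m, hs ⟨hm₁, hm₂.le⟩⟩, hm₂⟩⟩
  have hmax (i : ι) : NoMaxOrder ((↑) ⁻¹' U i : Set ℚ) := ⟨fun a => by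
    obtain ⟨l, hl, hs⟩ := exists_Ico_subset_of_mem_nhds ((hopen' i).mem_nhds a.2) (exists_gt a.1)
    obtain ⟨m, hm₁, hm₂⟩ := exists_between hl
    exact ⟨⟨m, hs ⟨hm₁.le, hm₂⟩⟩, hm₁⟩⟩
  have he (i : ι) : Nonempty (ℕ ≃ ChainSum ((↑) ⁻¹' U i)) := by
    have : Infinite (ChainSum ((↑) ⁻¹' U i)) := NoMinOrder.infinite
    exact nonempty_equiv_of_countable
  refine ⟨fun i => LinearOrder.lift' (he i).some (he i).some.injective, fun i j => ?_⟩
  rw [cvxEmb_lift_iff]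
  exact ⟨fun ⟨f, hf⟩ => ChainSum.subset_of_convex_embedding f hf,
    fun h => ChainSum.exists_convex_embedding h⟩

/-- Convex embeddability on linear orders on `ℕ` has chains of order type
`(ℝ, <)` and antichains of size continuum. -/
theorem cvxEmb_real_chain_and_continuum_antichain :
    (∃ L : ℝ → LinearOrder ℕ,
      ∀ x y : ℝ, x < y → CvxEmb (L x) (L y) ∧ ¬ CvxEmb (L y) (L x)) ∧
    (∃ M : ℝ → LinearOrder ℕ,
      ∀ x y : ℝ, x ≠ y → ¬ CvxEmb (M x) (M y)) := by
  constructor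
  · obtain ⟨L, hL⟩ := exists_cvxEmb_iff_preimage_subset (fun x : ℝ => Set.Iio x)
      (fun _ => isOpen_Iio) (fun _ => Set.nonempty_Iio) (fun _ => Set.ordConnected_Iio)
    refine ⟨L, fun x y hxy => ⟨(hL x y).2 fun q hq => lt_trans hq hxy, fun h => ?_⟩⟩
    obtain ⟨q, hxq, hqy⟩ := exists_rat_btwn hxy
    exact lt_asymm hxq ((hL y x).1 h hqy)
  · obtain ⟨M, hM⟩ := exists_cvxEmb_iff_preimage_subset (fun x : ℝ => Set.Ioo x (x + 1))
      (fun _ => isOpen_Ioo) (fun x => Set.nonempty_Ioo.2 (lt_add_one x))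
      (fun _ => Set.ordConnected_Ioo)
    refine ⟨M, fun x y hxy h => ?_⟩
    have hsub := (hM x y).1 h
    rcases lt_or_gt_of_ne hxy with hlt | hlt
    · obtain ⟨q, h₁, h₂⟩ := exists_rat_btwn (lt_min hlt (lt_add_one x))
      have hq : (q : ℝ) ∈ Set.Ioo y (y + 1) := hsub ⟨h₁, h₂.trans_le (min_le_right _ _)⟩
      exact lt_asymm hq.1 (h₂.trans_le (min_le_left _ _))
    · obtain ⟨q, h₁, h₂⟩ := exists_rat_btwn
        (max_lt (add_lt_add_left hlt 1) (lt_add_one x))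
      have hq : (q : ℝ) ∈ Set.Ioo y (y + 1) := hsub ⟨(le_max_right _ _).trans_lt h₁, h₂⟩
      exact lt_asymm hq.2 ((le_max_left _ _).trans_lt h₁)
end

section
/- The well-orders on ℕ form an unbounded family for convex embeddability, and every countable family is bounded: (1) for every linear order L on ℕ there exists a linear order W on ℕ whose strict order is well-founded (a well-order) such that W does not convexly embed into L; (2) for every sequence (L_n)_{n ∈ ℕ} of linear orders on ℕ there exists a linear order M on ℕ such that every L_n convexly embeds into M. Hence the unbounding number of convex embeddability on linear orders on ℕ is ℵ₁. -/
open Set Ordinal Cardinal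

universe u

section WellOrderedTail

variable {α β : Type*} [LinearOrder α] [LinearOrder β]

/-- The points `y ≥ x` such that the interval `[x, y]` is well-ordered. -/
def wellOrderedTail (x : α) : Set α :=
  {y | x ≤ y ∧ (Icc x y).IsWF}

theorem isWF_wellOrderedTail (x : α) : (wellOrderedTail x).IsWF := by
  refine wellFoundedOn_iff_no_descending_seq.2 fun f hf ↦ ?_
  refine wellFoundedOn_iff_no_descending_seq.1 (hf 0).2 f fun n ↦ ⟨(hf n).1, ?_⟩
  rcases Nat.eq_zero_or_pos n with rfl | hn
  · exact le_rfl
  · exact (f.map_rel_iff.2 hn).le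

instance wellFoundedLT_wellOrderedTail (x : α) : WellFoundedLT (wellOrderedTail x) :=
  ⟨isWF_wellOrderedTail x⟩

/-- A convex embedding of a nonempty well-order takes its values in the well-ordered tail of the
image of the least element. -/
theorem exists_range_subset_wellOrderedTail [WellFoundedLT β] [Nonempty β] (f : β ↪o α)
    (hf : (range f).OrdConnected) : ∃ x, range f ⊆ wellOrderedTail x := by
  obtain ⟨m, hm⟩ : ∃ m : β, ∀ b, m ≤ b :=
    ⟨wellFounded_lt.min univ univ_nonempty, fun b ↦ wellFounded_lt.min_le (mem_univ b)⟩
  have hwf : (range f).IsWF := by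
    rw [← image_univ]
    exact (IsWF.isPWO (wellFoundedOn_univ.2 wellFounded_lt)).image_of_monotone f.monotone |>.isWF
  refine ⟨f m, ?_⟩
  rintro _ ⟨b, rfl⟩
  exact ⟨f.monotone (hm b), hwf.mono (hf.out (mem_range_self m) (mem_range_self b))⟩

end WellOrderedTail

theorem type_lt_omega_one_of_countable {α : Type*} [LinearOrder α] [WellFoundedLT α]
    [Countable α] : typeLT α < ω₁ := by
  rw [lt_omega_iff_card_lt, card_type, ← succ_aleph0, Order.lt_succ_iff]
  exact mk_le_aleph0

/-- The well-orders that convexly embed into a countable linear order have order types bounded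
by a countable ordinal. -/
theorem exists_lt_omega_one_forall_type_le (α : Type u) [LinearOrder α] [Countable α] :
    ∃ o : Ordinal.{u}, o < ω₁ ∧ ∀ (β : Type u) [LinearOrder β] [WellFoundedLT β] [Nonempty β] (f : β ↪o α),
      (range f).OrdConnected → typeLT β ≤ o := by
  refine ⟨⨆ x : α, typeLT (wellOrderedTail x),
    iSup_lt_omega_one fun x ↦ type_lt_omega_one_of_countable, ?_⟩
  intro β _ _ _ f hf
  obtain ⟨x, hx⟩ := exists_range_subset_wellOrderedTail f hf
  refine le_trans ?_ (Ordinal.le_iSup (fun x : α ↦ typeLT (wellOrderedTail x)) x)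
  exact type_le_iff'.2 ⟨(OrderEmbedding.ofStrictMono (fun b ↦ ⟨f b, hx (mem_range_self b)⟩)
    fun _ _ h ↦ f.strictMono h).ltEmbedding⟩

/-- Every countably infinite linear order is isomorphic to a linear order on `ℕ`. -/
theorem exists_linearOrder_nat_equiv (α : Type*) [LinearOrder α] [Countable α] [Infinite α] :
    ∃ (L : LinearOrder ℕ) (e : ℕ ≃ α), ∀ a b, L.le a b ↔ e a ≤ e b := by
  obtain ⟨_⟩ := nonempty_denumerable α
  exact ⟨LinearOrder.lift' (Denumerable.eqv α).symm (Denumerable.eqv α).symm.injective,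
    (Denumerable.eqv α).symm, fun _ _ ↦ Iff.rfl⟩

/-- The natural numbers equipped with the linear order `L`. -/
def WithOrder (_ : LinearOrder ℕ) : Type := ℕ

instance (L : LinearOrder ℕ) : LinearOrder (WithOrder L) := L

instance (L : LinearOrder ℕ) : Countable (WithOrder L) := inferInstanceAs (Countable ℕ)

instance (L : LinearOrder ℕ) : Infinite (WithOrder L) := inferInstanceAs (Infinite ℕ)

theorem exists_wellOrder_not_cvxEmb (L : LinearOrder ℕ) :
    ∃ W : LinearOrder ℕ, WellFounded W.lt ∧ ¬ CvxEmb W L := by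
  obtain ⟨o, ho, hbound⟩ := exists_lt_omega_one_forall_type_le (WithOrder L)
  have hlt : max ω (Order.succ o) < ω₁ :=
    max_lt omega0_lt_omega_one ((isSuccLimit_omega 1).succ_lt ho)
  set p := max ω (Order.succ o)
  have : Countable p.ToType := by
    rw [lt_omega_iff_card_lt, ← succ_aleph0, Order.lt_succ_iff] at hlt
    rwa [← mk_le_aleph0_iff, mk_toType]
  have : Infinite p.ToType := by
    rw [infinite_iff, mk_toType, ← card_omega0]
    exact card_le_card (le_max_left _ _)
  obtain ⟨W, e, he⟩ := exists_linearOrder_nat_equiv p.ToType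
  have hlt_iff : ∀ a b, W.lt a b ↔ e a < e b := fun a b ↦ by
    rw [W.lt_iff_le_not_ge, he, he, lt_iff_le_not_ge]
  refine ⟨W, ?_, ?_⟩
  · exact Subrelation.wf (fun {a b} h ↦ (hlt_iff a b).1 h) (InvImage.wf e wellFounded_lt)
  · rintro ⟨f, hf, hconv⟩
    let g : p.ToType ↪o WithOrder L := OrderEmbedding.ofMapLEIff (fun a ↦ f (e.symm a))
      fun a b ↦ (hf _ _).symm.trans ((he _ _).trans (by simp))
    have hrange : range g = range f := e.symm.surjective.range_comp f
    have hle : typeLT p.ToType ≤ o := by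
      refine hbound p.ToType g ⟨fun x hx z hz y hy ↦ ?_⟩
      rw [hrange] at hx hz ⊢
      exact hconv x y z hy.1 hy.2 hx hz
    rw [type_toType] at hle
    exact absurd ((le_max_right _ _).trans hle) (Order.lt_succ o).not_ge

/-- The lexicographic sum of countably many linear orders on `ℕ` bounds all of them. -/
theorem exists_forall_cvxEmb (Ls : ℕ → LinearOrder ℕ) :
    ∃ M : LinearOrder ℕ, ∀ n, CvxEmb (Ls n) M := by
  have : Countable (Σₗ n, WithOrder (Ls n)) := inferInstanceAs (Countable (Σ n, WithOrder (Ls n)))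
  have : Infinite (Σₗ n, WithOrder (Ls n)) := inferInstanceAs (Infinite (Σ n, WithOrder (Ls n)))
  obtain ⟨M, e, he⟩ := exists_linearOrder_nat_equiv (Σₗ n, WithOrder (Ls n))
  have hfst : ∀ {a b : Σₗ n, WithOrder (Ls n)}, a ≤ b → a.1 ≤ b.1 := fun {a b} h ↦ by
    rcases Sigma.Lex.le_def.1 h with h | ⟨h, -⟩
    exacts [h.le, h.le]
  refine ⟨M, fun n ↦ ⟨fun a ↦ e.symm (toLex ⟨n, a⟩), fun a b ↦ ?_, ?_⟩⟩
  · rw [he, e.apply_symm_apply, e.apply_symm_apply, Sigma.Lex.le_def]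
    exact ⟨fun h ↦ .inr ⟨rfl, h⟩, fun h ↦ h.elim (fun h ↦ absurd h (lt_irrefl n)) fun ⟨_, h⟩ ↦ h⟩
  · rintro _ y _ hxy hyz ⟨a, rfl⟩ ⟨b, rfl⟩
    rw [he, e.apply_symm_apply] at hxy hyz
    have hn : (e y).1 = n := le_antisymm (hfst hyz) (hfst hxy)
    obtain ⟨c, hc⟩ : ∃ c : WithOrder (Ls n), e y = toLex ⟨n, c⟩ := by
      generalize e y = s at hn
      obtain ⟨m, c⟩ := s
      subst hn
      exact ⟨c, rfl⟩
    exact ⟨c, e.symm_apply_eq.2 hc.symm⟩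

/-- (1) The well-orders on `ℕ` form an unbounded family for convex
embeddability: for every linear order `L` on `ℕ` there is a well-order `W` on
`ℕ` (a linear order whose strict relation is well-founded) not convexly
embedding into `L`.  (2) Every countable family of linear orders on `ℕ` is
bounded for convex embeddability.  Hence `𝔟(⊴) = ℵ₁`. -/
theorem wellOrders_unbounded_and_countable_families_bounded :
    (∀ L : LinearOrder ℕ, ∃ W : LinearOrder ℕ,
        WellFounded W.lt ∧ ¬ CvxEmb W L) ∧
    (∀ Ls : ℕ → LinearOrder ℕ, ∃ M : LinearOrder ℕ, ∀ n : ℕ, CvxEmb (Ls n) M) :=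
  ⟨exists_wellOrder_not_cvxEmb, exists_forall_cvxEmb⟩
end

section
/- Every linear order L on ℕ is the bottom element of a strictly increasing, unbounded chain of length ω₁ for convex embeddability: there is a family (L_α) of linear orders on ℕ indexed by the ordinals α < ω₁ such that L_0 is order-isomorphic to L; for all α < β < ω₁, L_α convexly embeds into L_β but L_β does not convexly embed into L_α; and for every linear order M on ℕ there is some α < ω₁ such that L_α does not convexly embed into M. -/
/-- `L` and `L'` are order-isomorphic linear orders on `ℕ`. -/
def IsoNat (L L' : LinearOrder ℕ) : Prop :=
  ∃ f : ℕ ≃ ℕ, ∀ a b : ℕ, L.le a b ↔ L'.le (f a) (f b)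

open Set
open scoped Ordinal

universe u v w

/-- `X` is order-isomorphic to a convex subset of `Y`. -/
def ConvexEmbeds (X : Type u) (Y : Type v) [LinearOrder X] [LinearOrder Y] : Prop :=
  ∃ f : X ↪o Y, (range f).OrdConnected

section ConvexEmbeds

variable {X : Type u} {Y : Type v} {Z : Type w} [LinearOrder X] [LinearOrder Y] [LinearOrder Z]

theorem convexEmbeds_iff :
    ConvexEmbeds X Y ↔ ∃ f : X → Y, (∀ a b, a ≤ b ↔ f a ≤ f b) ∧
      ∀ x y z, x ≤ y → y ≤ z → x ∈ range f → z ∈ range f → y ∈ range f := by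
  constructor
  · rintro ⟨f, hc⟩
    exact ⟨f, fun a b => f.le_iff_le.symm, fun x y z hxy hyz hx hz => hc.out hx hz ⟨hxy, hyz⟩⟩
  · rintro ⟨f, hf, hc⟩
    exact ⟨OrderEmbedding.ofMapLEIff f fun a b => (hf a b).symm,
      ⟨fun x hx z hz y hy => hc x y z hy.1 hy.2 hx hz⟩⟩

theorem ConvexEmbeds.trans (hXY : ConvexEmbeds X Y) (hYZ : ConvexEmbeds Y Z) :
    ConvexEmbeds X Z := by
  obtain ⟨f, hf⟩ := hXY
  obtain ⟨g, hg⟩ := hYZ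
  refine ⟨f.trans g, ⟨?_⟩⟩
  rintro _ ⟨a, rfl⟩ _ ⟨b, rfl⟩ z hz
  obtain ⟨y, rfl⟩ := hg.out ⟨f a, rfl⟩ ⟨f b, rfl⟩ hz
  have hy : y ∈ Icc (f a) (f b) := by simpa using hz
  obtain ⟨x, rfl⟩ := hf.out ⟨a, rfl⟩ ⟨b, rfl⟩ hy
  exact ⟨x, rfl⟩

theorem OrderIso.convexEmbeds (e : X ≃o Y) : ConvexEmbeds X Y :=
  ⟨e.toOrderEmbedding, by
    have : range e.toOrderEmbedding = univ := e.surjective.range_eq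
    rw [this]
    exact ordConnected_univ⟩

theorem OrderIso.convexEmbeds_congr {X' : Type*} {Y' : Type*} [LinearOrder X'] [LinearOrder Y']
    (e : X ≃o X') (e' : Y ≃o Y') : ConvexEmbeds X Y ↔ ConvexEmbeds X' Y' :=
  ⟨fun h => (e.symm.convexEmbeds.trans h).trans e'.convexEmbeds,
    fun h => (e.convexEmbeds.trans h).trans e'.symm.convexEmbeds⟩

end ConvexEmbeds

theorem cvxEmb_iff_convexEmbeds (L M : LinearOrder ℕ) :
    CvxEmb L M ↔ @ConvexEmbeds ℕ ℕ L M :=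
  (@convexEmbeds_iff ℕ ℕ L M).symm

/-- The linear order `N` on `ℕ` is a copy of the linear order `X`. -/
def IsCopy (N : LinearOrder ℕ) (X : Type u) [LinearOrder X] : Prop :=
  ∃ e : ℕ ≃ X, ∀ a b, N.le a b ↔ e a ≤ e b

theorem exists_isCopy (X : Type u) [LinearOrder X] [Countable X] [Infinite X] :
    ∃ N, IsCopy N X := by
  obtain ⟨e⟩ : Nonempty (ℕ ≃ X) := by
    obtain ⟨_⟩ := nonempty_denumerable X
    exact ⟨(Denumerable.eqv X).symm⟩
  exact ⟨LinearOrder.lift' e e.injective, e, fun _ _ => Iff.rfl⟩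

theorem IsCopy.exists_orderIso {N : LinearOrder ℕ} {X : Type u} [LinearOrder X]
    (h : IsCopy N X) : Nonempty (@OrderIso ℕ X N.toLE _) := by
  obtain ⟨e, he⟩ := h
  exact ⟨e, fun {a b} => (he a b).symm⟩

theorem IsCopy.cvxEmb_iff {N M : LinearOrder ℕ} {X : Type u} {Y : Type v}
    [LinearOrder X] [LinearOrder Y] (hN : IsCopy N X) (hM : IsCopy M Y) :
    CvxEmb N M ↔ ConvexEmbeds X Y := by
  obtain ⟨e⟩ := hN.exists_orderIso
  obtain ⟨e'⟩ := hM.exists_orderIso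
  rw [cvxEmb_iff_convexEmbeds]
  exact @OrderIso.convexEmbeds_congr ℕ ℕ N M X Y _ _ e e'

section Ordinals

variable {X : Type v} [LinearOrder X]

/-- Along a convex embedding of an ordinal, a position is determined by the image of `0` and
the image of that position. -/
theorem le_of_convex_images_eq {γ γ' α α' : Ordinal.{u}} (f : Iio γ ↪o X) (f' : Iio γ' ↪o X)
    (hf : (range f).OrdConnected) (hα : α < γ) (hα' : α' < γ')
    (h0 : f ⟨0, hα.bot_lt⟩ = f' ⟨0, hα'.bot_lt⟩) (h : f ⟨α, hα⟩ = f' ⟨α', hα'⟩) :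
    α' ≤ α := by
  by_contra! hlt
  have hex : ∀ ξ : Iio α', ∃ η : Iio γ, f η = f' ⟨ξ, lt_trans ξ.2 hα'⟩ := by
    intro ξ
    apply hf.out ⟨_, h0⟩ ⟨_, h⟩
    constructor
    · exact f'.le_iff_le.2 (Subtype.mk_le_mk.2 bot_le)
    · exact f'.le_iff_le.2 (Subtype.mk_le_mk.2 (le_of_lt ξ.2))
  choose g hg using hex
  have hmono : ∀ ξ ζ : Iio α', ξ < ζ → g ξ < g ζ := by
    intro ξ ζ hξζ
    rw [← f.lt_iff_lt, hg, hg, f'.lt_iff_lt]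
    exact hξζ
  have hle : ∀ ξ (hξ : ξ < α'), ξ ≤ (g ⟨ξ, hξ⟩ : Ordinal) := by
    intro ξ
    induction ξ using WellFoundedLT.induction with
    | ind ξ ih =>
      intro hξ
      refine le_of_forall_lt fun ζ hζ => ?_
      exact (ih ζ hζ (hζ.trans hξ)).trans_lt (hmono ⟨ζ, hζ.trans hξ⟩ ⟨ξ, hξ⟩ hζ)
  have h₁ : f ⟨α, hα⟩ ≤ f (g ⟨α, hlt⟩) := f.le_iff_le.2 (hle α hlt)
  rw [hg, h, f'.le_iff_le] at h₁
  exact absurd hlt (not_lt.2 h₁)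

theorem countable_Iio_of_lt_omega_one {γ : Ordinal.{u}} (h : γ < ω₁) : Countable (Iio γ) := by
  rw [← Cardinal.mk_le_aleph0_iff, Cardinal.mk_Iio_ordinal, Cardinal.lift_le_aleph0]
  rwa [← Cardinal.ord_aleph, Cardinal.lt_ord, ← Cardinal.succ_aleph0, Order.lt_succ_iff] at h

theorem not_countable_Iio_omega_one : ¬ Countable (Iio (ω₁ : Ordinal.{u})) := by
  rw [← Cardinal.mk_le_aleph0_iff, Cardinal.mk_Iio_ordinal, Cardinal.lift_le_aleph0,
    Ordinal.card_omega, not_le]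
  exact Cardinal.aleph0_lt_aleph_one

/-- The ordinals convexly embedding into a countable linear order are bounded below `ω₁`. -/
theorem exists_lt_omega_one_not_convexEmbeds (X : Type v) [LinearOrder X] [Countable X] :
    ∃ δ < (ω₁ : Ordinal.{u}), ∀ γ, δ < γ → ¬ ConvexEmbeds (Iio γ) X := by
  by_contra! H
  choose γ hγ f hf using H
  refine not_countable_Iio_omega_one.{u} (Function.Injective.countable
    (f := fun α : Iio (ω₁ : Ordinal.{u}) =>
      (f α α.2 ⟨0, (hγ α α.2).bot_lt⟩, f α α.2 ⟨α, hγ α α.2⟩)) ?_)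
  intro α β h
  obtain ⟨h0, h1⟩ := Prod.mk.inj h
  exact Subtype.ext (le_antisymm (le_of_convex_images_eq _ _ (hf _ _) _ _ h0.symm h1.symm)
    (le_of_convex_images_eq _ _ (hf _ _) _ _ h0 h1))

theorem convexEmbeds_sumLex_right (A : Type v) [LinearOrder A] (B : Type w) [LinearOrder B] :
    ConvexEmbeds B (A ⊕ₗ B) := by
  refine ⟨OrderEmbedding.ofMapLEIff Sum.inrₗ fun a b => Sum.Lex.inr_le_inr_iff, ⟨?_⟩⟩
  rintro _ ⟨a, rfl⟩ _ ⟨b, rfl⟩ z ⟨hz, -⟩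
  induction z using Lex.rec with | _ z
  rcases z with z | z
  · exact absurd hz Sum.Lex.not_inr_le_inl
  · exact ⟨z, rfl⟩

theorem convexEmbeds_sumLex_Iio (A : Type v) [LinearOrder A] {α β : Ordinal.{u}} (h : α ≤ β) :
    ConvexEmbeds (A ⊕ₗ Iio α) (A ⊕ₗ Iio β) := by
  let ι : Iio α → Iio β := inclusion (Iio_subset_Iio h)
  refine ⟨OrderEmbedding.ofMapLEIff
    (fun x => toLex (Sum.map id ι (ofLex x))) ?_, ⟨?_⟩⟩
  · intro x y
    induction x using Lex.rec with | _ x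
    induction y using Lex.rec with | _ y
    rcases x with x | x <;> rcases y with y | y <;> simp [ι]
  · rintro _ ⟨a, rfl⟩ _ ⟨b, rfl⟩ z ⟨-, hz⟩
    induction z using Lex.rec with | _ z
    induction b using Lex.rec with | _ b
    rcases z with z | z
    · exact ⟨toLex (Sum.inl z), rfl⟩
    · rcases b with b | b
      · exact absurd hz Sum.Lex.not_inr_le_inl
      · have hz' : z ≤ ι b := Sum.Lex.inr_le_inr_iff.1 hz
        exact ⟨toLex (Sum.inr ⟨z, lt_of_le_of_lt (show (z : Ordinal) ≤ b from hz') b.2⟩), rfl⟩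

/-- A sequence of ordinals whose value at `β` is at least `d` of every earlier value. -/
noncomputable def dominatingSeq (d : Ordinal.{u} → Ordinal.{u}) (β : Ordinal.{u}) : Ordinal.{u} :=
  ⨆ α : Iio β, d (dominatingSeq d α)
termination_by β
decreasing_by exact α.2

theorem dominatingSeq_zero (d : Ordinal.{u} → Ordinal.{u}) : dominatingSeq d 0 = 0 := by
  rw [dominatingSeq]
  have : IsEmpty (Iio (0 : Ordinal.{u})) := ⟨fun x => not_lt_bot (a := x.1) x.2⟩
  exact ciSup_of_empty _

theorem le_dominatingSeq (d : Ordinal.{u} → Ordinal.{u}) {α β : Ordinal.{u}} (h : α < β) :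
    d (dominatingSeq d α) ≤ dominatingSeq d β := by
  conv_rhs => rw [dominatingSeq]
  exact Ordinal.le_iSup (fun α : Iio β => d (dominatingSeq d α)) ⟨α, h⟩

theorem dominatingSeq_lt_omega_one {d : Ordinal.{u} → Ordinal.{u}} (hd : ∀ γ < ω₁, d γ < ω₁)
    (β : Ordinal.{u}) (hβ : β < ω₁) : dominatingSeq d β < ω₁ := by
  induction β using WellFoundedLT.induction with
  | ind β ih =>
    have := countable_Iio_of_lt_omega_one hβ
    rw [dominatingSeq]
    exact Ordinal.iSup_lt_omega_one fun α => hd _ (ih α α.2 (lt_trans α.2 hβ))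

end Ordinals

theorem exists_chain_above (A : Type v) [LinearOrder A] [Countable A] [Infinite A] :
    ∃ C : Ordinal.{u} → LinearOrder ℕ,
      IsCopy (C 0) A ∧
      (∀ α β : Ordinal.{u}, α < β → β < ω₁ →
        CvxEmb (C α) (C β) ∧ ¬ CvxEmb (C β) (C α)) ∧
      (∀ M : LinearOrder ℕ, ∃ α : Ordinal.{u}, α < ω₁ ∧ ¬ CvxEmb (C α) M) := by
  have hN : ∀ γ : Ordinal.{u}, γ < ω₁ → ∃ N, IsCopy N (A ⊕ₗ Iio γ) := by
    intro γ hγ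
    have := countable_Iio_of_lt_omega_one hγ
    have : Countable (A ⊕ₗ Iio γ) := inferInstanceAs (Countable (A ⊕ Iio γ))
    have : Infinite (A ⊕ₗ Iio γ) := inferInstanceAs (Infinite (A ⊕ Iio γ))
    exact exists_isCopy _
  have hd : ∀ γ : Ordinal.{u}, γ < ω₁ → ∃ δ < (ω₁ : Ordinal.{u}), γ < δ ∧
      ∀ γ', δ ≤ γ' → ¬ ConvexEmbeds (A ⊕ₗ Iio γ') (A ⊕ₗ Iio γ) := by
    intro γ hγ
    have := countable_Iio_of_lt_omega_one hγ
    have : Countable (A ⊕ₗ Iio γ) := inferInstanceAs (Countable (A ⊕ Iio γ))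
    obtain ⟨δ, hδ, h⟩ := exists_lt_omega_one_not_convexEmbeds.{u} (A ⊕ₗ Iio γ)
    refine ⟨Order.succ (max γ δ), (Cardinal.isSuccLimit_omega 1).succ_lt (max_lt hγ hδ),
      Order.lt_succ_of_le (le_max_left _ _), fun γ' hγ' hemb => ?_⟩
    exact h γ' ((le_max_right _ _).trans_lt (Order.succ_le_iff.1 hγ'))
      ((convexEmbeds_sumLex_right A _).trans hemb)
  have : Nonempty (LinearOrder ℕ) := ⟨inferInstance⟩
  choose! N hN using hN
  choose! d hd hlt hd' using hd
  have hg := dominatingSeq_lt_omega_one hd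
  refine ⟨fun α => N (dominatingSeq d α), ?_, ?_, ?_⟩
  · have h0 := hN 0 (Ordinal.omega_pos 1)
    obtain ⟨e, he⟩ := h0
    have hempty : IsEmpty (Iio (0 : Ordinal.{u})) := ⟨fun x => not_lt_bot (a := x.1) x.2⟩
    let i : A ≃ A ⊕ₗ Iio (0 : Ordinal.{u}) := (Equiv.sumEmpty A _).symm.trans toLex
    have hi : ∀ a b, i a ≤ i b ↔ a ≤ b := fun a b => Sum.Lex.inl_le_inl_iff
    simp only [dominatingSeq_zero]
    refine ⟨e.trans i.symm, fun a b => ?_⟩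
    rw [he, ← hi]
    simp
  · intro α β hαβ hβ
    have hα := hαβ.trans hβ
    have hle := le_dominatingSeq d hαβ
    simp only [(hN _ (hg α hα)).cvxEmb_iff (hN _ (hg β hβ)),
      (hN _ (hg β hβ)).cvxEmb_iff (hN _ (hg α hα))]
    exact ⟨convexEmbeds_sumLex_Iio A ((hlt _ (hg α hα)).le.trans hle), hd' _ (hg α hα) _ hle⟩
  · intro M
    obtain ⟨δ, hδ, h⟩ := @exists_lt_omega_one_not_convexEmbeds.{u} ℕ M _
    have hM : @IsCopy M ℕ M := ⟨Equiv.refl ℕ, fun _ _ => Iff.rfl⟩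
    have hself : ∀ α < (ω₁ : Ordinal.{u}), α ≤ dominatingSeq d α := by
      intro α
      induction α using WellFoundedLT.induction with
      | ind α ih =>
        intro hα
        refine le_of_forall_lt fun ζ hζ => ?_
        have hζ' := hζ.trans hα
        exact ((ih ζ hζ hζ').trans_lt (hlt _ (hg ζ hζ'))).trans_le (le_dominatingSeq d hζ)
    have hs : Order.succ δ < ω₁ := (Cardinal.isSuccLimit_omega 1).succ_lt hδ
    refine ⟨Order.succ δ, hs, fun hemb => ?_⟩
    rw [@IsCopy.cvxEmb_iff _ M _ ℕ _ M (hN _ (hg _ hs)) hM] at hemb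
    exact h _ ((Order.lt_succ δ).trans_le (hself _ hs))
      (@ConvexEmbeds.trans _ _ _ _ _ M (convexEmbeds_sumLex_right A _) hemb)

/-- Every linear order `L` on `ℕ` is the bottom of a strictly increasing,
unbounded chain of length `ω₁` for convex embeddability. -/
theorem cvxEmb_unbounded_omega1_chain_above (L : LinearOrder ℕ) :
    ∃ C : Ordinal → LinearOrder ℕ,
      IsoNat (C 0) L ∧
      (∀ α β : Ordinal, α < β → β < (Cardinal.aleph 1).ord →
        CvxEmb (C α) (C β) ∧ ¬ CvxEmb (C β) (C α)) ∧
      (∀ M : LinearOrder ℕ, ∃ α : Ordinal, α < (Cardinal.aleph 1).ord ∧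
        ¬ CvxEmb (C α) M) := by
  simp only [Cardinal.ord_aleph]
  exact @exists_chain_above ℕ L _ _
end

section
/- There is a family of continuum-many linear orders on ℕ that are pairwise incomparable under convex embeddability and each of which is minimal for convex embeddability: there exists an injective family (L_x)_{x ∈ 2^ℕ} of linear orders on ℕ such that (1) for every x and every linear order M on ℕ, if M convexly embeds into L_x then L_x convexly embeds into M; and (2) for distinct x, y, neither L_x convexly embeds into L_y nor L_y into L_x. In particular, every basis for convex embeddability on linear orders on ℕ has cardinality continuum. -/
open Set

/-- The exponent of `3` in the denominator of a rational number. -/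
def denVal (q : ℚ) : ℕ := (-padicValRat 3 q).toNat

/-- The size of the finite block replacing the rational `q` in the order attached to `x`. -/
def blockSize (x : ℕ → Bool) (q : ℚ) : ℕ := 2 * denVal q + (x (denVal q)).toNat + 1

/-- The open rational interval `(0, 1)` with each `q` replaced by a block of size
`blockSize x q`. -/
abbrev BlockSum (x : ℕ → Bool) : Type :=
  {p : ℚ ×ₗ ℕ // (0 < (ofLex p).1 ∧ (ofLex p).1 < 1) ∧ (ofLex p).2 < blockSize x (ofLex p).1}

theorem padicValRat_three_two_pow (l : ℕ) : padicValRat 3 ((2 : ℚ) ^ l) = 0 := by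
  have : Fact (Nat.Prime 3) := ⟨Nat.prime_three⟩
  have h : padicValRat 3 (2 : ℚ) = 0 := by
    have : padicValNat 3 2 = 0 := padicValNat.eq_zero_of_not_dvd (by norm_num)
    simpa [this] using padicValRat.of_nat (p := 3) (n := 2)
  rw [padicValRat.pow, h, mul_zero]

theorem denVal_natCast_add (j : ℕ) {q : ℚ} (hq : 0 < q) : denVal (j + q) = denVal q := by
  have : Fact (Nat.Prime 3) := ⟨Nat.prime_three⟩
  rcases Nat.eq_zero_or_pos j with rfl | hj
  · simp
  have hj' : (0 : ℚ) < j := by exact_mod_cast hj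
  have hjv : 0 ≤ padicValRat 3 (j : ℚ) := by
    rw [padicValRat.of_nat]; positivity
  unfold denVal
  rcases lt_or_ge (padicValRat 3 q) 0 with h | h
  · rw [add_comm, padicValRat.add_eq_of_lt (by positivity) hq.ne' hj'.ne' (h.trans_le hjv)]
  · have := padicValRat.min_le_padicValRat_add (p := 3) (q := (j : ℚ)) (r := q) (by positivity)
    have := (le_min hjv h).trans this
    omega

theorem denVal_affine (j l : ℕ) {q : ℚ} (hq : 0 < q) :
    denVal ((j + q) / 2 ^ l) = denVal q := by
  have : Fact (Nat.Prime 3) := ⟨Nat.prime_three⟩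
  rw [← denVal_natCast_add j hq]
  unfold denVal
  rw [padicValRat.div (by positivity) (by positivity), padicValRat_three_two_pow, sub_zero]

theorem exists_denVal_eq (n : ℕ) : ∃ q : ℚ, 0 < q ∧ q < 1 ∧ denVal q = n := by
  have : Fact (Nat.Prime 3) := ⟨Nat.prime_three⟩
  have h3 : (1 : ℚ) ≤ 3 ^ n := one_le_pow₀ (by norm_num)
  refine ⟨(3 ^ n)⁻¹ / 2 ^ 1, by positivity, ?_, ?_⟩
  · have := inv_le_one_of_one_le₀ h3
    linarith
  · have h := denVal_affine 0 1 (q := (3 ^ n)⁻¹) (by positivity)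
    rw [Nat.cast_zero, zero_add] at h
    rw [h]
    unfold denVal
    rw [padicValRat.inv, padicValRat.pow]
    have : padicValRat 3 (3 : ℚ) = 1 := by
      simpa using padicValRat.self (p := 3) (by norm_num)
    simp [this]

theorem exists_dyadic_between {p q : ℚ} (hp : 0 < p) (hpq : p < q) :
    ∃ j l : ℕ, p < j / 2 ^ l ∧ (j + 1) / 2 ^ l < q := by
  obtain ⟨l, hl⟩ := pow_unbounded_of_one_lt (2 / (q - p)) (show (1 : ℚ) < 2 by norm_num)
  have h2 : (0 : ℚ) < 2 ^ l := by positivity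
  rw [div_lt_iff₀ (sub_pos.2 hpq)] at hl
  refine ⟨⌊p * 2 ^ l⌋₊ + 1, l, ?_, ?_⟩
  · rw [lt_div_iff₀ h2]
    exact_mod_cast Nat.lt_floor_add_one (p * 2 ^ l)
  · rw [div_lt_iff₀ h2]
    have := Nat.floor_le (show 0 ≤ p * 2 ^ l by positivity)
    push_cast
    linarith

namespace BlockSum

variable {x y : ℕ → Bool}

/-- The rational coordinate. -/
def base (a : BlockSum x) : ℚ := (ofLex a.1).1

/-- The position inside the block. -/
def pos (a : BlockSum x) : ℕ := (ofLex a.1).2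

/-- The `i`-th point of the block at `q`. -/
def mk (q : ℚ) (i : ℕ) (h0 : 0 < q) (h1 : q < 1) (hi : i < blockSize x q) : BlockSum x :=
  ⟨toLex (q, i), ⟨h0, h1⟩, hi⟩

@[simp] theorem base_mk (q : ℚ) (i : ℕ) (h0 : 0 < q) (h1 : q < 1) (hi : i < blockSize x q) :
    base (mk q i h0 h1 hi) = q := rfl

@[simp] theorem pos_mk (q : ℚ) (i : ℕ) (h0 : 0 < q) (h1 : q < 1) (hi : i < blockSize x q) :
    pos (mk q i h0 h1 hi) = i := rfl

theorem base_pos (a : BlockSum x) : 0 < base a := a.2.1.1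

theorem base_lt_one (a : BlockSum x) : base a < 1 := a.2.1.2

theorem pos_lt (a : BlockSum x) : pos a < blockSize x (base a) := a.2.2

theorem blockSize_pos (x : ℕ → Bool) (q : ℚ) : 0 < blockSize x q := Nat.succ_pos _

theorem lt_iff {a b : BlockSum x} :
    a < b ↔ base a < base b ∨ base a = base b ∧ pos a < pos b :=
  Prod.Lex.lt_iff

theorem le_iff {a b : BlockSum x} :
    a ≤ b ↔ base a < base b ∨ base a = base b ∧ pos a ≤ pos b :=
  Prod.Lex.le_iff

theorem base_le_of_le {a b : BlockSum x} (h : a ≤ b) : base a ≤ base b := by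
  rcases le_iff.1 h with h | h
  exacts [h.le, h.1.le]

theorem ext {a b : BlockSum x} (h : base a = base b) (h' : pos a = pos b) : a = b :=
  Subtype.ext (ofLex.injective (Prod.ext h h'))

theorem exists_lt (a : BlockSum x) : ∃ b, b < a := by
  have := base_pos a
  have := base_lt_one a
  exact ⟨mk (base a / 2) 0 (by linarith) (by linarith) (blockSize_pos _ _),
    lt_iff.2 (Or.inl (by simp; linarith))⟩

theorem exists_gt (a : BlockSum x) : ∃ b, a < b := by
  have := base_pos a
  have := base_lt_one a
  exact ⟨mk ((base a + 1) / 2) 0 (by linarith) (by linarith) (blockSize_pos _ _),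
    lt_iff.2 (Or.inl (by simp; linarith))⟩

instance : Infinite (BlockSum x) := by
  have : NoMinOrder (BlockSum x) := ⟨exists_lt⟩
  have : Nonempty (BlockSum x) :=
    ⟨mk (1 / 2) 0 (by norm_num) (by norm_num) (blockSize_pos _ _)⟩
  exact NoMinOrder.infinite

instance : Countable (BlockSum x) :=
  (Function.Injective.countable (f := fun a : BlockSum x => (base a, pos a))
    fun _ _ h => ext (congrArg Prod.fst h) (congrArg Prod.snd h))

theorem covBy_iff {a b : BlockSum x} : a ⋖ b ↔ base a = base b ∧ pos b = pos a + 1 := by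
  constructor
  · rintro ⟨hab, hno⟩
    rcases lt_iff.1 hab with h | ⟨h, h'⟩
    · refine absurd (hno (c := mk ((base a + base b) / 2) 0 ?_ ?_ (blockSize_pos _ _))
        (lt_iff.2 (Or.inl ?_))) (not_not.2 (lt_iff.2 (Or.inl ?_)))
      · linarith [base_pos a, base_pos b]
      · linarith [base_lt_one a, base_lt_one b]
      · simp; linarith
      · simp; linarith
    · refine ⟨h, (Nat.succ_le_of_lt h').antisymm' (not_lt.1 fun hlt => ?_)⟩
      refine hno (c := mk (base a) (pos a + 1) (base_pos a) (base_lt_one a) ?_)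
        (lt_iff.2 (Or.inr ⟨rfl, Nat.lt_succ_self _⟩)) (lt_iff.2 (Or.inr ⟨h, hlt⟩))
      rw [h]
      exact hlt.trans (pos_lt b)
  · rintro ⟨h, h'⟩
    refine ⟨lt_iff.2 (Or.inr ⟨h, by omega⟩), fun c hac hcb => ?_⟩
    rcases lt_iff.1 hac with h1 | ⟨h1, h1'⟩ <;> rcases lt_iff.1 hcb with h2 | ⟨h2, h2'⟩
    · linarith
    · linarith
    · linarith
    · omega

theorem exists_covBy_iff {a : BlockSum x} : (∃ b, b ⋖ a) ↔ pos a ≠ 0 := by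
  constructor
  · rintro ⟨b, hb⟩
    have := (covBy_iff.1 hb).2
    omega
  · intro h
    have hlt : pos a - 1 < blockSize x (base a) := (Nat.sub_le _ _).trans_lt (pos_lt a)
    exact ⟨mk (base a) (pos a - 1) (base_pos a) (base_lt_one a) hlt,
      covBy_iff.2 ⟨rfl, by rw [pos_mk]; omega⟩⟩

theorem exists_covBy_iff' {a : BlockSum x} :
    (∃ b, a ⋖ b) ↔ pos a + 1 < blockSize x (base a) := by
  constructor
  · rintro ⟨b, hb⟩
    have := covBy_iff.1 hb
    rw [← this.2, this.1]
    exact pos_lt b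
  · intro h
    exact ⟨mk (base a) (pos a + 1) (base_pos a) (base_lt_one a) h, covBy_iff.2 ⟨rfl, rfl⟩⟩

/-- A convex embedding maps each block onto a block. -/
theorem blockSize_eq_of_convex_embedding (f : BlockSum x ↪o BlockSum y)
    (hf : (range f).OrdConnected) {q : ℚ} (h0 : 0 < q) (h1 : q < 1) :
    ∃ r, blockSize y r = blockSize x q := by
  have pred (a : BlockSum x) : (∃ b, b ⋖ f a) → ∃ b, b ⋖ a := by
    rintro ⟨b, hb⟩
    obtain ⟨a', ha'⟩ := exists_lt a
    obtain ⟨c, rfl⟩ := hf.out (mem_range_self a') (mem_range_self a)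
      ⟨hb.le_of_lt (f.lt_iff_lt.2 ha'), hb.1.le⟩
    exact ⟨c, (hf.apply_covBy_apply_iff f).1 hb⟩
  have succ (a : BlockSum x) : (∃ b, f a ⋖ b) → ∃ b, a ⋖ b := by
    rintro ⟨b, hb⟩
    obtain ⟨a', ha'⟩ := exists_gt a
    obtain ⟨c, rfl⟩ := hf.out (mem_range_self a) (mem_range_self a')
      ⟨hb.1.le, hb.ge_of_gt (f.lt_iff_lt.2 ha')⟩
    exact ⟨c, (hf.apply_covBy_apply_iff f).1 hb⟩
  set r := base (f (mk q 0 h0 h1 (blockSize_pos _ _)))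
  have key (m : ℕ) (hm : m < blockSize x q) :
      base (f (mk q m h0 h1 hm)) = r ∧ pos (f (mk q m h0 h1 hm)) = m := by
    induction m with
    | zero =>
      refine ⟨rfl, ?_⟩
      by_contra h
      exact exists_covBy_iff.1 (pred _ (exists_covBy_iff.2 h)) rfl
    | succ m ih =>
      have ih := ih (by omega)
      have hc : (mk q m h0 h1 (by omega) : BlockSum x) ⋖ mk q (m + 1) h0 h1 hm :=
        covBy_iff.2 ⟨rfl, rfl⟩
      have := covBy_iff.1 ((hf.apply_covBy_apply_iff f).2 hc)
      exact ⟨this.1 ▸ ih.1, by rw [this.2, ih.2]⟩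
  refine ⟨r, ?_⟩
  have hs := blockSize_pos x q
  have hm : blockSize x q - 1 < blockSize x q := by omega
  obtain ⟨hb, hp⟩ := key _ hm
  have hlt := pos_lt (f (mk q _ h0 h1 hm))
  have hmax : ¬ pos (f (mk q _ h0 h1 hm)) + 1 < blockSize y (base (f (mk q _ h0 h1 hm))) := by
    intro h
    have := exists_covBy_iff'.1 (succ _ (exists_covBy_iff'.2 h))
    simp only [pos_mk, base_mk] at this
    omega
  rw [hb, hp] at hlt hmax
  omega

theorem eq_of_convex_embedding (f : BlockSum x ↪o BlockSum y)
    (hf : (range f).OrdConnected) : x = y := by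
  funext n
  obtain ⟨q, h0, h1, rfl⟩ := exists_denVal_eq n
  obtain ⟨r, hr⟩ := blockSize_eq_of_convex_embedding f hf h0 h1
  unfold blockSize at hr
  have hx := Bool.toNat_le (x (denVal q))
  have hy := Bool.toNat_le (y (denVal r))
  have h : denVal r = denVal q := by omega
  rw [h] at hr
  cases hxq : x (denVal q) <;> cases hyq : y (denVal q) <;> simp [hxq, hyq] at hr ⊢

/-- Between two different blocks there is a convex copy of the whole order. -/
theorem exists_convex_copy_between {a b : BlockSum x} (hab : base a < base b) :
    ∃ f : BlockSum x ↪o BlockSum x, (range f).OrdConnected ∧ ∀ c, a ≤ f c ∧ f c ≤ b := by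
  obtain ⟨j, l, hj, hl⟩ := exists_dyadic_between (base_pos a) hab
  have h2 : (0 : ℚ) < 2 ^ l := by positivity
  have lo (c : BlockSum x) : base a < (j + base c) / 2 ^ l :=
    hj.trans ((div_lt_div_iff_of_pos_right h2).2 (by linarith [base_pos c]))
  have hi (c : BlockSum x) : (j + base c) / 2 ^ l < base b :=
    ((div_lt_div_iff_of_pos_right h2).2 (by linarith [base_lt_one c])).trans hl
  have size {q : ℚ} (hq : 0 < q) : blockSize x ((j + q) / 2 ^ l) = blockSize x q := by
    unfold blockSize
    rw [denVal_affine j l hq]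
  let φ (c : BlockSum x) : BlockSum x := mk ((j + base c) / 2 ^ l) (pos c)
    ((base_pos a).trans (lo c)) ((hi c).trans (base_lt_one b))
    (by rw [size (base_pos c)]; exact pos_lt c)
  have hφ (c d : BlockSum x) : φ c ≤ φ d ↔ c ≤ d := by
    simp only [le_iff, φ, base_mk, pos_mk, div_lt_div_iff_of_pos_right h2, add_lt_add_iff_left,
      div_left_inj' h2.ne', add_right_inj]
  refine ⟨OrderEmbedding.ofMapLEIff φ hφ, ⟨?_⟩, fun c => ⟨?_, ?_⟩⟩
  · rintro _ ⟨c, rfl⟩ _ ⟨d, rfl⟩ e ⟨hce, hed⟩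
    have h1 : (j + base c) / 2 ^ l ≤ base e := base_le_of_le hce
    have h3 : base e ≤ (j + base d) / 2 ^ l := base_le_of_le hed
    rw [div_le_iff₀ h2] at h1
    rw [le_div_iff₀ h2] at h3
    have hpos : 0 < base e * 2 ^ l - j := by linarith [base_pos c]
    have he : (j + (base e * 2 ^ l - j)) / 2 ^ l = base e := by
      field_simp
      ring
    refine ⟨mk (base e * 2 ^ l - j) (pos e) hpos (by linarith [base_lt_one d]) ?_, ext he rfl⟩
    rw [← size hpos, he]
    exact pos_lt e
  · exact le_iff.2 (Or.inl (lo c))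
  · exact le_iff.2 (Or.inl (hi c))

theorem exists_base_lt_of_injective (g : ℕ → BlockSum x) (hg : Function.Injective g) :
    ∃ m n, base (g m) < base (g n) := by
  by_contra! h
  have hb (n : ℕ) : base (g n) = base (g 0) := le_antisymm (h 0 n) (h n 0)
  have hinj : Function.Injective fun n : ℕ =>
      (⟨pos (g n), hb n ▸ pos_lt (g n)⟩ : Fin (blockSize x (base (g 0)))) := by
    intro m n hmn
    exact hg (ext ((hb m).trans (hb n).symm) (Fin.ext_iff.1 hmn))
  exact not_injective_infinite_finite _ hinj

/-- An enumeration of the points of the order. -/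
noncomputable def enum (x : ℕ → Bool) : ℕ ≃ BlockSum x :=
  Classical.choice (nonempty_equiv_of_countable)

/-- The copy of `BlockSum x` on `ℕ`. -/
@[reducible] noncomputable def order (x : ℕ → Bool) : LinearOrder ℕ :=
  LinearOrder.lift' (enum x) (enum x).injective

theorem order_le_iff {m n : ℕ} : (order x).le m n ↔ enum x m ≤ enum x n := Iff.rfl

theorem eq_of_cvxEmb (h : CvxEmb (order x) (order y)) : x = y := by
  obtain ⟨f, hf, hconv⟩ := h
  have hle (a b : BlockSum x) :
      enum y (f ((enum x).symm a)) ≤ enum y (f ((enum x).symm b)) ↔ a ≤ b := by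
    rw [← order_le_iff, ← hf, order_le_iff, Equiv.apply_symm_apply, Equiv.apply_symm_apply]
  refine eq_of_convex_embedding (OrderEmbedding.ofMapLEIff _ hle) ⟨?_⟩
  rintro _ ⟨a, rfl⟩ _ ⟨b, rfl⟩ c ⟨hac, hcb⟩
  obtain ⟨k, hk⟩ := hconv _ ((enum y).symm c) _
    (order_le_iff.2 (by rw [Equiv.apply_symm_apply]; exact hac))
    (order_le_iff.2 (by rw [Equiv.apply_symm_apply]; exact hcb))
    (mem_range_self _) (mem_range_self _)
  exact ⟨enum x k, by simp [hk]⟩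

theorem cvxEmb_order_of_cvxEmb {M : LinearOrder ℕ} (h : CvxEmb M (order x)) :
    CvxEmb (order x) M := by
  obtain ⟨g, hg, hconv⟩ := h
  have ginj : Function.Injective fun n => enum x (g n) := by
    intro m n hmn
    exact M.le_antisymm m n ((hg m n).2 (order_le_iff.2 hmn.le))
      ((hg n m).2 (order_le_iff.2 hmn.ge))
  obtain ⟨m, n, hmn⟩ := exists_base_lt_of_injective _ ginj
  obtain ⟨φ, hφ, hφb⟩ := exists_convex_copy_between hmn
  have hex (k : ℕ) : ∃ i, enum x (g i) = φ (enum x k) := by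
    obtain ⟨i, hi⟩ := hconv _ ((enum x).symm (φ (enum x k))) _
      (order_le_iff.2 (by rw [Equiv.apply_symm_apply]; exact (hφb _).1))
      (order_le_iff.2 (by rw [Equiv.apply_symm_apply]; exact (hφb _).2))
      (mem_range_self m) (mem_range_self n)
    exact ⟨i, by simp [hi]⟩
  choose f hf using hex
  refine ⟨f, fun a b => ?_, ?_⟩
  · rw [hg, order_le_iff, order_le_iff, hf, hf, φ.le_iff_le]
  · rintro _ k _ h1 h2 ⟨a, rfl⟩ ⟨b, rfl⟩
    rw [hg, order_le_iff, hf] at h1 h2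
    obtain ⟨c, hc⟩ := hφ.out (mem_range_self _) (mem_range_self _) ⟨h1, h2⟩
    refine ⟨(enum x).symm c, ginj ?_⟩
    simp only [hf, Equiv.apply_symm_apply, hc]

end BlockSum

theorem CvxEmb.refl (L : LinearOrder ℕ) : CvxEmb L L :=
  ⟨id, fun _ _ => Iff.rfl, fun _ y _ _ _ _ _ => ⟨y, rfl⟩⟩

theorem CvxEmb.trans {L M N : LinearOrder ℕ} (h : CvxEmb L M) (h' : CvxEmb M N) :
    CvxEmb L N := by
  obtain ⟨f, hf, hfc⟩ := h
  obtain ⟨g, hg, hgc⟩ := h'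
  refine ⟨g ∘ f, fun a b => (hf a b).trans (hg _ _), ?_⟩
  rintro _ y _ h1 h2 ⟨a, rfl⟩ ⟨b, rfl⟩
  obtain ⟨c, rfl⟩ := hgc _ y _ h1 h2 (mem_range_self _) (mem_range_self _)
  obtain ⟨d, rfl⟩ := hfc _ c _ ((hg _ _).2 h1) ((hg _ _).2 h2) (mem_range_self _) (mem_range_self _)
  exact ⟨d, rfl⟩

theorem mk_linearOrder_nat_le : Cardinal.mk (LinearOrder ℕ) ≤ Cardinal.continuum := by
  have hinj : Function.Injective fun (L : LinearOrder ℕ) => {p : ℕ × ℕ | L.le p.1 p.2} := by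
    intro L M h
    refine LinearOrder.ext fun a b => ?_
    exact iff_of_eq <| congrArg (fun s : Set (ℕ × ℕ) => (a, b) ∈ s) h
  refine (Cardinal.mk_le_of_injective hinj).trans ?_
  simp

/-- There is an injective family, indexed by `2^ℕ`, of pairwise
`⊴`-incomparable, `⊴`-minimal linear orders on `ℕ`; in particular every basis
for convex embeddability has cardinality continuum. -/
theorem cvxEmb_continuum_many_minimal_and_bases_large :
    (∃ L : (ℕ → Bool) → LinearOrder ℕ, Function.Injective L ∧
      (∀ x : ℕ → Bool, ∀ M : LinearOrder ℕ, CvxEmb M (L x) → CvxEmb (L x) M) ∧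
      (∀ x y : ℕ → Bool, x ≠ y → ¬ CvxEmb (L x) (L y))) ∧
    (∀ B : Set (LinearOrder ℕ),
      (∀ L : LinearOrder ℕ, ∃ L' ∈ B, CvxEmb L' L) →
      Cardinal.mk B = Cardinal.continuum) := by
  refine ⟨⟨BlockSum.order, fun x y h => BlockSum.eq_of_cvxEmb (h ▸ CvxEmb.refl _),
    fun _ _ => BlockSum.cvxEmb_order_of_cvxEmb, fun _ _ hxy h => hxy (BlockSum.eq_of_cvxEmb h)⟩,
    fun B hB => le_antisymm ((Cardinal.mk_set_le B).trans mk_linearOrder_nat_le) ?_⟩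
  choose b hb hbL using fun x => hB (BlockSum.order x)
  have hinj : Function.Injective fun x => (⟨b x, hb x⟩ : B) := by
    intro x y hxy
    have hxy : b x = b y := congrArg Subtype.val hxy
    exact BlockSum.eq_of_cvxEmb
      ((BlockSum.cvxEmb_order_of_cvxEmb (hbL x)).trans (hxy ▸ hbL y))
  simpa using Cardinal.mk_le_of_injective hinj
end

section
/- Every antichain for convex embeddability on linear orders on ℕ is contained in such an antichain of cardinality continuum: if 𝒜 is a set of linear orders on ℕ such that any two distinct members of 𝒜 are incomparable under convex embeddability, then there is a set ℬ ⊇ 𝒜 of linear orders on ℕ, of cardinality exactly the continuum, whose distinct members are pairwise incomparable under convex embeddability. In particular, every linear order on ℕ belongs to an antichain of size continuum. -/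
/-- A set of linear orders on `ℕ` whose distinct members are pairwise
`⊴`-incomparable. -/
def CvxAntichain (A : Set (LinearOrder ℕ)) : Prop :=
  ∀ L ∈ A, ∀ L' ∈ A, L ≠ L' → ¬ CvxEmb L L'

open Set

/-- `f` is an order embedding with convex range. -/
structure ConvexEmb {α β : Type*} [LinearOrder α] [LinearOrder β] (f : α → β) : Prop where
  strictMono : StrictMono f
  ordConnected : (range f).OrdConnected

namespace ConvexEmb

variable {α β : Type*} [LinearOrder α] [LinearOrder β] {f : α → β}

theorem of_le_iff (h : ∀ a b, a ≤ b ↔ f a ≤ f b)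
    (hconv : ∀ x y z, x ≤ y → y ≤ z → x ∈ range f → z ∈ range f → y ∈ range f) :
    ConvexEmb f :=
  ⟨strictMono_of_le_iff_le h, ⟨fun _ hx _ hz _ hy => hconv _ _ _ hy.1 hy.2 hx hz⟩⟩

theorem exists_eq (hf : ConvexEmb f) {a b : α} {y : β} (ha : f a ≤ y) (hb : y ≤ f b) :
    ∃ c, f c = y :=
  hf.ordConnected.out (mem_range_self a) (mem_range_self b) ⟨ha, hb⟩

theorem image_Icc (hf : ConvexEmb f) (a b : α) : f '' Icc a b = Icc (f a) (f b) := by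
  ext y
  constructor
  · rintro ⟨x, hx, rfl⟩
    exact ⟨hf.strictMono.monotone hx.1, hf.strictMono.monotone hx.2⟩
  · rintro ⟨h₁, h₂⟩
    obtain ⟨c, rfl⟩ := hf.exists_eq h₁ h₂
    exact ⟨c, ⟨hf.strictMono.le_iff_le.1 h₁, hf.strictMono.le_iff_le.1 h₂⟩, rfl⟩

/-- The inverse of a convex embedding, restricted to a convex subset of its range, is a
convex embedding. -/
theorem exists_of_subset_range (hf : ConvexEmb f) {W : Set β} (hW : W.OrdConnected)
    (h : W ⊆ range f) : ∃ g : W → α, ConvexEmb g := by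
  choose g hg using fun w : W => h w.2
  refine ⟨g, fun v w hvw => ?_, ⟨?_⟩⟩
  · rw [← hf.strictMono.lt_iff_lt, hg, hg]
    exact hvw
  · rintro _ ⟨v, rfl⟩ _ ⟨w, rfl⟩ x ⟨hx₁, hx₂⟩
    have hx : f x ∈ W := by
      refine hW.out v.2 w.2 ⟨?_, ?_⟩
      · rw [← hg v]; exact hf.strictMono.monotone hx₁
      · rw [← hg w]; exact hf.strictMono.monotone hx₂
    exact ⟨⟨f x, hx⟩, hf.strictMono.injective (hg _)⟩

end ConvexEmb

/-- `Icc a b` is an interior finite block with `n + 1` elements: `a` has no immediate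
predecessor and `b` has no immediate successor. -/
structure IsBlock {α : Type*} [LinearOrder α] (n : ℕ) (a b : α) : Prop where
  ncard_Icc : (Icc a b).ncard = n + 1
  exists_lt : ∃ c, c < a
  exists_gt : ∃ c, b < c
  left : ∀ c < a, ∃ d, c < d ∧ d < a
  right : ∀ c, b < c → ∃ d, b < d ∧ d < c

/-- The rationals whose denominator has a given smallest prime factor are dense. -/
theorem exists_rat_btwn_minFac_den {p : ℕ} (hp : p.Prime) {a b : ℚ} (hab : a < b) :
    ∃ q : ℚ, a < q ∧ q < b ∧ q.den.minFac = p := by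
  obtain ⟨j, hj⟩ := pow_unbounded_of_one_lt ((p : ℚ) / (b - a))
    (show (1 : ℚ) < p by exact_mod_cast hp.one_lt)
  have hp0 : (0 : ℚ) < p := by exact_mod_cast hp.pos
  have hpj : (0 : ℚ) < (p : ℚ) ^ (j + 1) := by positivity
  have hj' : (p : ℚ) < (b - a) * (p : ℚ) ^ (j + 1) := by
    rw [div_lt_iff₀ (sub_pos.2 hab)] at hj
    calc (p : ℚ) < p ^ j * (b - a) := hj
      _ ≤ p ^ (j + 1) * (b - a) := by
        have : (1 : ℚ) ≤ p := by exact_mod_cast hp.one_le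
        have h2 : (p : ℚ) ^ j ≤ p ^ (j + 1) := pow_le_pow_right₀ this (by omega)
        exact mul_le_mul_of_nonneg_right h2 (sub_pos.2 hab).le
      _ = _ := mul_comm _ _
  set m : ℤ := ⌊(a * (p : ℚ) ^ (j + 1) - 1) / p⌋ + 1 with hm
  have hm₁ : (a * (p : ℚ) ^ (j + 1) - 1) / p < m := by
    rw [hm]; push_cast; exact Int.lt_floor_add_one _
  have hm₂ : (m : ℚ) - 1 ≤ (a * (p : ℚ) ^ (j + 1) - 1) / p := by
    rw [hm]; push_cast; simpa using Int.floor_le _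
  rw [div_lt_iff₀ hp0] at hm₁
  rw [le_div_iff₀ hp0] at hm₂
  refine ⟨((m * p + 1 : ℤ) : ℚ) / ((p ^ (j + 1) : ℤ) : ℚ), ?_, ?_, ?_⟩
  · push_cast
    rw [lt_div_iff₀ hpj]
    linarith
  · push_cast
    rw [div_lt_iff₀ hpj]
    linarith
  · have hcop : (m * p + 1 : ℤ).natAbs.Coprime ((p ^ (j + 1) : ℤ).natAbs) := by
      rw [← Int.isCoprime_iff_nat_coprime]
      exact IsCoprime.pow_right ⟨1, -m, by ring⟩
    have hden := Rat.den_div_eq_of_coprime (by exact_mod_cast pow_pos hp.pos _) hcop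
    have : (((m * p + 1 : ℤ) : ℚ) / ((p ^ (j + 1) : ℤ) : ℚ)).den = p ^ (j + 1) := by
      exact_mod_cast hden
    rw [this, hp.pow_minFac (by omega)]

open Classical in
/-- The last index of the block placed at the rational `q`. -/
noncomputable def blockTop (S : Set Nat.Primes) (q : ℚ) : ℕ :=
  if ∃ p ∈ S, (p : ℕ) = q.den.minFac then q.den.minFac else 0

/-- The shuffle over `ℚ` of the singleton and of the finite orders with `p + 1` elements,
`p ∈ S`. -/
def Shuffle (S : Set Nat.Primes) : Type :=
  {x : ℚ ×ₗ ℕ // (ofLex x).2 ≤ blockTop S (ofLex x).1}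

noncomputable instance (S : Set Nat.Primes) : LinearOrder (Shuffle S) :=
  inferInstanceAs (LinearOrder {x : ℚ ×ₗ ℕ // (ofLex x).2 ≤ blockTop S (ofLex x).1})

namespace Shuffle

variable {S T : Set Nat.Primes}

/-- The point of index `i` in the block at `q`. -/
def mk (q : ℚ) (i : ℕ) (h : i ≤ blockTop S q) : Shuffle S := ⟨toLex (q, i), h⟩

/-- The rational at which the block of `x` is placed. -/
def base (x : Shuffle S) : ℚ := (ofLex x.1).1

/-- The index of `x` in its block. -/
def index (x : Shuffle S) : ℕ := (ofLex x.1).2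

theorem index_le (x : Shuffle S) : x.index ≤ blockTop S x.base := x.2

@[simp] theorem base_mk (q : ℚ) (i : ℕ) (h : i ≤ blockTop S q) : (mk q i h).base = q := rfl

@[simp] theorem index_mk (q : ℚ) (i : ℕ) (h : i ≤ blockTop S q) : (mk q i h).index = i := rfl

theorem lt_iff {x y : Shuffle S} :
    x < y ↔ x.base < y.base ∨ x.base = y.base ∧ x.index < y.index :=
  Prod.Lex.lt_iff

theorem le_iff {x y : Shuffle S} :
    x ≤ y ↔ x.base < y.base ∨ x.base = y.base ∧ x.index ≤ y.index :=
  Prod.Lex.le_iff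

theorem ext {x y : Shuffle S} (h₁ : x.base = y.base) (h₂ : x.index = y.index) : x = y :=
  Subtype.ext (Prod.ext h₁ h₂)

instance : Countable (Shuffle S) :=
  inferInstanceAs (Countable {x : ℚ × ℕ // x.2 ≤ blockTop S x.1})

theorem infinite_Icc {x y : Shuffle S} (h : x.base < y.base) : (Icc x y).Infinite := by
  have hinj : Function.Injective fun q : ℚ => (mk q 0 (Nat.zero_le _) : Shuffle S) :=
    fun q r hqr => congrArg base hqr
  refine ((Ioo_infinite h).image hinj.injOn).mono ?_
  rintro _ ⟨q, hq, rfl⟩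
  exact ⟨le_iff.2 (Or.inl hq.1), le_iff.2 (Or.inl hq.2)⟩

instance : Infinite (Shuffle S) :=
  infinite_univ_iff.1 ((infinite_Icc (x := (mk 0 0 (Nat.zero_le _) : Shuffle S))
    (y := mk 1 0 (Nat.zero_le _)) (by simp)).mono (subset_univ _))

theorem exists_infinite_Icc (x : Shuffle S) : ∃ y, (Icc x y).Infinite :=
  ⟨mk (x.base + 1) 0 (Nat.zero_le _), infinite_Icc (by simp)⟩

theorem ncard_block (q : ℚ) :
    (Icc (mk q 0 (Nat.zero_le _) : Shuffle S) (mk q (blockTop S q) le_rfl)).ncard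
      = blockTop S q + 1 := by
  have : Icc (mk q 0 (Nat.zero_le _) : Shuffle S) (mk q (blockTop S q) le_rfl)
      = range fun i : Fin (blockTop S q + 1) =>
          (mk q i (Nat.lt_succ_iff.1 i.2) : Shuffle S) := by
    ext x
    simp only [mem_Icc, le_iff, base_mk, index_mk, mem_range]
    constructor
    · rintro ⟨h₁, h₂⟩
      have hq : x.base = q := by grind
      refine ⟨⟨x.index, ?_⟩, ext hq.symm rfl⟩
      have := x.index_le
      rw [hq] at this
      omega
    · rintro ⟨i, rfl⟩
      simp only [base_mk, index_mk]
      have := i.2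
      exact ⟨Or.inr ⟨trivial, Nat.zero_le _⟩, Or.inr ⟨trivial, by omega⟩⟩
  rw [this, ← image_univ, ncard_image_of_injective, ncard_univ, Nat.card_eq_fintype_card,
    Fintype.card_fin]
  exact fun i j hij => Fin.ext (congrArg index hij)

theorem finite_block (q : ℚ) : {x : Shuffle S | x.base = q}.Finite := by
  refine Finite.of_finite_image (f := index)
    ((finite_Iic (blockTop S q)).subset ?_) fun x hx y hy hxy => ext (hx.trans hy.symm) hxy
  rintro _ ⟨x, rfl, rfl⟩
  exact x.index_le

theorem mem_of_isBlock {W : Type*} [LinearOrder W] {f : W → Shuffle S} (hf : ConvexEmb f)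
    {p : Nat.Primes} {a b : W} (h : IsBlock (p : ℕ) a b) : p ∈ S := by
  have ha : (f a).index = 0 := by
    by_contra hi
    obtain ⟨c, hc⟩ := h.exists_lt
    have hfc := lt_iff.1 (hf.strictMono hc)
    have hle := (f a).index_le
    obtain ⟨d, hd⟩ := hf.exists_eq (a := c) (b := a)
      (y := mk (f a).base ((f a).index - 1) (by omega))
      (by rw [le_iff]; simp only [base_mk, index_mk]; grind)
      (by rw [le_iff]; simp only [base_mk, index_mk]; grind)
    have hda : d < a := by
      rw [← hf.strictMono.lt_iff_lt, hd, lt_iff]; simp only [base_mk, index_mk]; grind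
    obtain ⟨e, he₁, he₂⟩ := h.left d hda
    have he₁' := lt_iff.1 (hf.strictMono he₁)
    have he₂' := lt_iff.1 (hf.strictMono he₂)
    rw [hd] at he₁'
    simp only [base_mk, index_mk] at he₁'
    grind
  have hb : (f b).index = blockTop S (f b).base := by
    by_contra hi
    obtain ⟨c, hc⟩ := h.exists_gt
    have hfc := lt_iff.1 (hf.strictMono hc)
    have hle := (f b).index_le
    obtain ⟨d, hd⟩ := hf.exists_eq (a := b) (b := c)
      (y := mk (f b).base ((f b).index + 1) (by omega))
      (by rw [le_iff]; simp only [base_mk, index_mk]; grind)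
      (by rw [le_iff]; simp only [base_mk, index_mk]; grind)
    have hda : b < d := by
      rw [← hf.strictMono.lt_iff_lt, hd, lt_iff]; simp only [base_mk, index_mk]; grind
    obtain ⟨e, he₁, he₂⟩ := h.right d hda
    have he₁' := lt_iff.1 (hf.strictMono he₁)
    have he₂' := lt_iff.1 (hf.strictMono he₂)
    rw [hd] at he₂'
    simp only [base_mk, index_mk] at he₂'
    grind
  have hfin : (Icc a b).Finite := finite_of_ncard_ne_zero (by rw [h.ncard_Icc]; omega)
  have hab : a ≤ b := by
    rw [← nonempty_Icc, ← ncard_pos hfin, h.ncard_Icc]; omega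
  have hbase : (f a).base = (f b).base := by
    rcases le_iff.1 (hf.strictMono.monotone hab) with hlt | heq
    · exact absurd (hf.image_Icc a b ▸ hfin.image f) (infinite_Icc hlt)
    · exact heq.1
  have hcard := ncard_block (S := S) (f a).base
  have ha' : mk (f a).base 0 (Nat.zero_le _) = f a := ext rfl ha.symm
  have hb' : mk (f a).base (blockTop S (f a).base) le_rfl = f b :=
    ext hbase (by rw [hb, ← hbase]; rfl)
  rw [ha', hb', ← hf.image_Icc, ncard_image_of_injective _ hf.strictMono.injective,
    h.ncard_Icc] at hcard
  have hp := p.2.pos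
  unfold blockTop at hcard
  split_ifs at hcard with hS
  · obtain ⟨r, hr, hr'⟩ := hS
    have : p = r := Subtype.ext (by omega)
    exact this ▸ hr
  · omega

theorem exists_isBlock {W : Type*} [LinearOrder W] [Infinite W] {f : W → Shuffle S}
    (hf : ConvexEmb f) {p : Nat.Primes} (hp : p ∈ S) : ∃ a b : W, IsBlock (p : ℕ) a b := by
  obtain ⟨v, w, hvw⟩ : ∃ v w, (f v).base < (f w).base := by
    by_contra! hcon
    obtain ⟨w₀⟩ : Nonempty W := inferInstance
    refine infinite_range_of_injective hf.strictMono.injective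
      ((finite_block (f w₀).base).subset ?_)
    rintro _ ⟨w, rfl⟩
    exact le_antisymm (hcon _ _) (hcon _ _)
  obtain ⟨q, hvq, hqw, hq⟩ := exists_rat_btwn_minFac_den p.2 hvw
  have key : ∀ x : Shuffle S, (f v).base < x.base → x.base < (f w).base → ∃ c, f c = x :=
    fun x h₁ h₂ => hf.exists_eq (le_iff.2 (Or.inl h₁)) (le_iff.2 (Or.inl h₂))
  obtain ⟨a, ha⟩ := key (mk q 0 (Nat.zero_le _)) hvq hqw
  obtain ⟨b, hb⟩ := key (mk q (blockTop S q) le_rfl) hvq hqw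
  have hlt : ∀ {x y : W}, x < y ↔ f x < f y := hf.strictMono.lt_iff_lt.symm
  have hva : v < a := by rw [hlt, ha, lt_iff]; exact Or.inl hvq
  have hbw : b < w := by rw [hlt, hb, lt_iff]; exact Or.inl hqw
  refine ⟨a, b, ?_, ⟨v, hva⟩, ⟨w, hbw⟩, fun c hc => ?_, fun c hc => ?_⟩
  · rw [← ncard_image_of_injective _ hf.strictMono.injective, hf.image_Icc, ha, hb,
      ncard_block, blockTop, if_pos ⟨p, hp, hq.symm⟩, hq]
  · have hc' : (f c).base < q := by
      rw [hlt, ha, lt_iff] at hc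
      simpa using hc
    obtain ⟨r, hr₁, hr₂⟩ := exists_between (max_lt hc' hvq)
    obtain ⟨d, hd⟩ := key (mk r 0 (Nat.zero_le _)) ((le_max_right _ _).trans_lt hr₁)
      (hr₂.trans hqw)
    refine ⟨d, ?_, ?_⟩
    · rw [hlt, hd, lt_iff]; exact Or.inl ((le_max_left _ _).trans_lt hr₁)
    · rw [hlt, hd, ha, lt_iff]; exact Or.inl hr₂
  · have hc' : q < (f c).base := by
      rw [hlt, hb, lt_iff] at hc
      rcases hc with hc | ⟨h₁, h₂⟩
      · exact hc
      · have := (f c).index_le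
        simp only [base_mk, index_mk] at h₁ h₂
        rw [← h₁] at this
        omega
    obtain ⟨r, hr₁, hr₂⟩ := exists_between (lt_min hc' hqw)
    obtain ⟨d, hd⟩ := key (mk r 0 (Nat.zero_le _)) (hvq.trans hr₁)
      (hr₂.trans_le (min_le_right _ _))
    refine ⟨d, ?_, ?_⟩
    · rw [hlt, hd, hb, lt_iff]; exact Or.inl hr₁
    · rw [hlt, hd, lt_iff]; exact Or.inl (hr₂.trans_le (min_le_left _ _))

/-- Shuffles with a common infinite convex suborder have the same parameter. -/
theorem eq_of_convexEmb {W : Type*} [LinearOrder W] [Infinite W] {f : W → Shuffle S}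
    {g : W → Shuffle T} (hf : ConvexEmb f) (hg : ConvexEmb g) : S = T := by
  ext p
  constructor
  · intro hp
    obtain ⟨a, b, h⟩ := exists_isBlock hf hp
    exact mem_of_isBlock hg h
  · intro hp
    obtain ⟨a, b, h⟩ := exists_isBlock hg hp
    exact mem_of_isBlock hf h

/-- Convex copies of two distinct shuffles in a linear order are disjoint. -/
theorem eq_of_apply_eq {W : Type*} [LinearOrder W] {f : Shuffle S → W} {g : Shuffle T → W}
    (hf : ConvexEmb f) (hg : ConvexEmb g) {s : Shuffle S} {t : Shuffle T} (h : f s = g t) :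
    S = T := by
  obtain ⟨s', hs'⟩ := exists_infinite_Icc s
  obtain ⟨t', ht'⟩ := exists_infinite_Icc t
  have hs := hf.image_Icc s s' ▸ hs'.image hf.strictMono.injective.injOn
  have ht := hg.image_Icc t t' ▸ ht'.image hg.strictMono.injective.injOn
  have hsub : Icc (f s) (f s') ∩ Icc (g t) (g t') ⊆ range f ∩ range g :=
    inter_subset_inter (hf.image_Icc s s' ▸ image_subset_range _ _)
      (hg.image_Icc t t' ▸ image_subset_range _ _)
  have hinf : (range f ∩ range g).Infinite := by
    refine Infinite.mono hsub ?_
    rw [h] at hs ⊢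
    rcases le_total (f s') (g t') with hle | hle
    · rwa [inter_eq_left.2 (Icc_subset_Icc_right hle)]
    · rwa [inter_eq_right.2 (Icc_subset_Icc_right hle)]
  have hord := hf.ordConnected.inter hg.ordConnected
  have := hinf.to_subtype
  obtain ⟨f', hf'⟩ := hf.exists_of_subset_range hord inter_subset_left
  obtain ⟨g', hg'⟩ := hg.exists_of_subset_range hord inter_subset_right
  exact eq_of_convexEmb hf' hg'

end Shuffle

/-- An enumeration of the shuffle with parameter `S`. -/
noncomputable def shuffleEquiv (S : Set Nat.Primes) : ℕ ≃ Shuffle S :=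
  (nonempty_equiv_of_countable (α := ℕ) (β := Shuffle S)).some

/-- The shuffle with parameter `S` as a linear order on `ℕ`. -/
@[reducible] noncomputable def shuffleOrder (S : Set Nat.Primes) : LinearOrder ℕ :=
  LinearOrder.lift' (shuffleEquiv S) (shuffleEquiv S).injective

theorem shuffleOrder_le (S : Set Nat.Primes) (a b : ℕ) :
    (shuffleOrder S).le a b ↔ shuffleEquiv S a ≤ shuffleEquiv S b := Iff.rfl

theorem CvxEmb.exists_to_shuffle {L : LinearOrder ℕ} {S : Set Nat.Primes}
    (h : CvxEmb L (shuffleOrder S)) : ∃ f : ℕ → Shuffle S, @ConvexEmb ℕ (Shuffle S) L _ f := by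
  obtain ⟨f, hle, hconv⟩ := h
  refine ⟨fun n => shuffleEquiv S (f n), @ConvexEmb.of_le_iff ℕ (Shuffle S) L _ _
    (fun a b => (hle a b).trans (shuffleOrder_le S _ _)) ?_⟩
  rintro _ x _ hx₁ hx₂ ⟨a, rfl⟩ ⟨b, rfl⟩
  obtain ⟨n, rfl⟩ := (shuffleEquiv S).surjective x
  obtain ⟨c, rfl⟩ := hconv _ n _ hx₁ hx₂ ⟨a, rfl⟩ ⟨b, rfl⟩
  exact ⟨c, rfl⟩

theorem CvxEmb.exists_of_shuffle {L : LinearOrder ℕ} {S : Set Nat.Primes}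
    (h : CvxEmb (shuffleOrder S) L) : ∃ f : Shuffle S → ℕ, @ConvexEmb (Shuffle S) ℕ _ L f := by
  obtain ⟨f, hle, hconv⟩ := h
  refine ⟨fun x => f ((shuffleEquiv S).symm x),
    @ConvexEmb.of_le_iff (Shuffle S) ℕ _ L _ (fun a b => ?_) ?_⟩
  · refine Iff.trans ?_ (hle _ _)
    rw [shuffleOrder_le, Equiv.apply_symm_apply, Equiv.apply_symm_apply]
  · rintro _ x _ hx₁ hx₂ ⟨a, rfl⟩ ⟨b, rfl⟩
    obtain ⟨c, rfl⟩ := hconv _ x _ hx₁ hx₂ ⟨_, rfl⟩ ⟨_, rfl⟩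
    exact ⟨shuffleEquiv S c, by simp⟩

theorem eq_of_cvxEmb_shuffleOrder {L : LinearOrder ℕ} {S T : Set Nat.Primes}
    (hS : CvxEmb L (shuffleOrder S)) (hT : CvxEmb L (shuffleOrder T)) : S = T := by
  obtain ⟨f, hf⟩ := hS.exists_to_shuffle
  obtain ⟨g, hg⟩ := hT.exists_to_shuffle
  exact Shuffle.eq_of_convexEmb hf hg

theorem shuffleOrder_injective : Function.Injective shuffleOrder := fun S _ h =>
  eq_of_cvxEmb_shuffleOrder (CvxEmb.refl (shuffleOrder S)) (h ▸ CvxEmb.refl _)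

/-- A linear order on `ℕ` is comparable to only countably many shuffles. -/
theorem countable_comparable_shuffleOrder (L : LinearOrder ℕ) :
    {S | CvxEmb (shuffleOrder S) L ∨ CvxEmb L (shuffleOrder S)}.Countable := by
  refine Countable.union (s := {S | CvxEmb (shuffleOrder S) L})
    (t := {S | CvxEmb L (shuffleOrder S)}) ?_ ?_
  · choose! f hf using fun S (h : CvxEmb (shuffleOrder S) L) => h.exists_of_shuffle
    rw [countable_iff_exists_injOn]
    exact ⟨fun S => f S (Shuffle.mk 0 0 (Nat.zero_le _)), fun S hS T hT hST =>
      Shuffle.eq_of_apply_eq (hf S hS) (hf T hT) hST⟩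
  · exact Set.Subsingleton.countable fun S hS T hT => eq_of_cvxEmb_shuffleOrder hS hT

theorem CvxAntichain.exists_superset_mk_eq_continuum {A : Set (LinearOrder ℕ)}
    (hA : CvxAntichain A) :
    ∃ B : Set (LinearOrder ℕ), A ⊆ B ∧ Cardinal.mk B = Cardinal.continuum ∧
      CvxAntichain B := by
  have hle : ∀ B : Set (LinearOrder ℕ), Cardinal.mk B ≤ Cardinal.continuum :=
    fun B => (Cardinal.mk_set_le B).trans mk_linearOrder_nat_le
  rcases (hle A).eq_or_lt with hcard | hcard
  · exact ⟨A, Subset.rfl, hcard, hA⟩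
  have hprimes : Cardinal.mk (Set Nat.Primes) = Cardinal.continuum := by
    simp
  set bad : Set (Set Nat.Primes) :=
    ⋃ L ∈ A, {S | CvxEmb (shuffleOrder S) L ∨ CvxEmb L (shuffleOrder S)}
  have hbad_lt : Cardinal.mk bad < Cardinal.continuum := by
    refine (Cardinal.mk_biUnion_le _ A).trans_lt
      (Cardinal.mul_lt_of_lt Cardinal.aleph0_le_continuum hcard ?_)
    refine lt_of_le_of_lt ?_ Cardinal.aleph0_lt_continuum
    exact ciSup_le' fun L => (countable_comparable_shuffleOrder L).le_aleph0
  have hgood : Cardinal.mk (badᶜ : Set (Set Nat.Primes)) = Cardinal.continuum := by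
    rw [Cardinal.mk_compl_of_infinite _ (by rwa [hprimes]), hprimes]
  have hinc : ∀ S ∈ badᶜ, ∀ L ∈ A,
      ¬ CvxEmb (shuffleOrder S) L ∧ ¬ CvxEmb L (shuffleOrder S) := by
    intro S hS L hL
    rw [← not_or]
    exact fun h => hS (mem_biUnion hL h)
  refine ⟨A ∪ shuffleOrder '' badᶜ, subset_union_left, le_antisymm (hle _) ?_, ?_⟩
  · rw [← hgood, ← Cardinal.mk_image_eq shuffleOrder_injective]
    exact Cardinal.mk_le_mk_of_subset subset_union_right
  · rintro L (hL | ⟨S, hS, rfl⟩) L' (hL' | ⟨T, hT, rfl⟩) hne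
    · exact hA L hL L' hL' hne
    · exact (hinc T hT L hL).2
    · exact (hinc S hS L' hL').1
    · exact fun h => hne (congrArg _ (eq_of_cvxEmb_shuffleOrder (CvxEmb.refl _) h))

/-- Every `⊴`-antichain of linear orders on `ℕ` is contained in a
`⊴`-antichain of cardinality continuum; in particular, every linear order on
`ℕ` belongs to an antichain of size continuum. -/
theorem cvxEmb_antichain_extends_to_continuum :
    (∀ A : Set (LinearOrder ℕ), CvxAntichain A →
      ∃ B : Set (LinearOrder ℕ), A ⊆ B ∧ Cardinal.mk B = Cardinal.continuum ∧
        CvxAntichain B) ∧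
    (∀ L : LinearOrder ℕ, ∃ B : Set (LinearOrder ℕ), L ∈ B ∧
      Cardinal.mk B = Cardinal.continuum ∧ CvxAntichain B) := by
  refine ⟨fun A hA => hA.exists_superset_mk_eq_continuum, fun L => ?_⟩
  obtain ⟨B, hLB, hB⟩ := CvxAntichain.exists_superset_mk_eq_continuum (A := {L})
    fun L₁ h₁ L₂ h₂ hne => absurd (h₁.trans h₂.symm) hne
  exact ⟨B, hLB rfl, hB⟩
end

section
/- A linear order L is right compressible if and only if there exists an order embedding f : L → L whose range is convex in L and such that some element of L is strictly greater than every element of the range of f. -/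
/-- A linear order `α` is right compressible if some proper initial segment
(a downward-closed subset different from the whole order) is order-isomorphic
to `α`. -/
def RightCompressible (α : Type*) [LinearOrder α] : Prop :=
  ∃ S : Set α, (∀ x ∈ S, ∀ y, y ≤ x → y ∈ S) ∧ S ≠ Set.univ ∧ Nonempty (α ≃o S)

/-- The points lying strictly below the whole range of some iterate of `f`. -/
def belowSomeIterate {α : Type*} [Preorder α] (f : α → α) : Set α :=
  {x | ∃ n : ℕ, ∀ y, x < f^[n] y}

lemma isLowerSet_belowSomeIterate {α : Type*} [Preorder α] (f : α → α) :
    IsLowerSet (belowSomeIterate f) := by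
  rintro x y hyx ⟨n, hn⟩
  exact ⟨n, fun z => hyx.trans_lt (hn z)⟩

lemma apply_mem_belowSomeIterate_iff {α : Type*} [Preorder α] (f : α ↪o α) (x : α) :
    f x ∈ belowSomeIterate f ↔ x ∈ belowSomeIterate f := by
  constructor
  · rintro ⟨_ | n, hn⟩
    · exact absurd (hn (f x)) (lt_irrefl _)
    · refine ⟨n, fun y => f.lt_iff_lt.1 ?_⟩
      simpa only [Function.iterate_succ_apply'] using hn y
  · rintro ⟨n, hn⟩
    refine ⟨n + 1, fun y => ?_⟩
    simpa only [Function.iterate_succ_apply', f.lt_iff_lt] using hn y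

lemma notMem_belowSomeIterate_of_forall_lt {α : Type*} [Preorder α] {f : α → α} {m : α}
    (hm : ∀ a, f a < m) : m ∉ belowSomeIterate f := by
  rintro ⟨_ | n, hn⟩
  · exact lt_irrefl m (hn m)
  · have h := hn m
    rw [Function.iterate_succ_apply'] at h
    exact lt_asymm h (hm _)

open Classical in
/-- The map fixing `belowSomeIterate f` pointwise and agreeing with `f` elsewhere. -/
noncomputable def fixBelow {α : Type*} [Preorder α] (f : α → α) (x : α) : α :=
  if x ∈ belowSomeIterate f then x else f x

lemma fixBelow_of_mem {α : Type*} [Preorder α] {f : α → α} {x : α}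
    (hx : x ∈ belowSomeIterate f) : fixBelow f x = x :=
  if_pos hx

lemma fixBelow_of_notMem {α : Type*} [Preorder α] {f : α → α} {x : α}
    (hx : x ∉ belowSomeIterate f) : fixBelow f x = f x :=
  if_neg hx

lemma strictMono_fixBelow {α : Type*} [LinearOrder α] (f : α ↪o α) :
    StrictMono (fixBelow f) := by
  intro x y hxy
  by_cases hy : y ∈ belowSomeIterate f
  · rwa [fixBelow_of_mem hy, fixBelow_of_mem (isLowerSet_belowSomeIterate f hxy.le hy)]
  · rw [fixBelow_of_notMem hy]
    by_cases hx : x ∈ belowSomeIterate f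
    · rw [fixBelow_of_mem hx]
      by_contra! h
      exact hy ((apply_mem_belowSomeIterate_iff f y).1 (isLowerSet_belowSomeIterate f h hx))
    · rwa [fixBelow_of_notMem hx, f.lt_iff_lt]

lemma isLowerSet_range_fixBelow {α : Type*} [LinearOrder α] (f : α ↪o α)
    (hf : (Set.range f).OrdConnected) : IsLowerSet (Set.range (fixBelow f)) := by
  rintro _ z hz ⟨x, rfl⟩
  by_cases hzP : z ∈ belowSomeIterate f
  · exact ⟨z, fixBelow_of_mem hzP⟩
  have hx : x ∉ belowSomeIterate f := fun hx =>
    hzP (isLowerSet_belowSomeIterate f (hz.trans_eq (fixBelow_of_mem hx)) hx)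
  obtain ⟨y, hy⟩ : ∃ y, f y ≤ z := by
    by_contra! h
    exact hzP ⟨1, h⟩
  rw [fixBelow_of_notMem hx] at hz
  obtain ⟨w, rfl⟩ := hf.out (Set.mem_range_self y) (Set.mem_range_self x) ⟨hy, hz⟩
  exact ⟨w, fixBelow_of_notMem fun hw => hzP ((apply_mem_belowSomeIterate_iff f w).2 hw)⟩

lemma notMem_range_fixBelow {α : Type*} [Preorder α] {f : α → α} {m : α}
    (hm : ∀ a, f a < m) : m ∉ Set.range (fixBelow f) := by
  rintro ⟨x, hx⟩
  by_cases hxP : x ∈ belowSomeIterate f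
  · rw [fixBelow_of_mem hxP] at hx
    exact notMem_belowSomeIterate_of_forall_lt hm (hx ▸ hxP)
  · rw [fixBelow_of_notMem hxP] at hx
    exact (hm x).ne hx

/-- `L` is right compressible iff there is an order embedding `f : L → L`
whose range is convex and such that some element of `L` is strictly greater
than every element of the range of `f`. -/
theorem rightCompressible_iff_convex_selfEmbedding (α : Type*) [LinearOrder α] :
    RightCompressible α ↔
      ∃ f : α ↪o α,
        (∀ x y z : α, x ≤ y → y ≤ z →
          x ∈ Set.range f → z ∈ Set.range f → y ∈ Set.range f) ∧
        ∃ m : α, ∀ a : α, f a < m := by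
  constructor
  · rintro ⟨S, hS, hne, ⟨e⟩⟩
    obtain ⟨m, hm⟩ := (Set.ne_univ_iff_exists_notMem S).1 hne
    refine ⟨e.toOrderEmbedding.trans (OrderEmbedding.subtype (· ∈ S)), ?_, m, fun a => ?_⟩
    · rintro _ y _ _ hyz _ ⟨c, rfl⟩
      exact ⟨e.symm ⟨y, hS _ (e c).2 y hyz⟩, by simp⟩
    · by_contra! h
      exact hm (hS _ (e a).2 m h)
  · rintro ⟨f, hconv, m, hm⟩
    have hf : (Set.range f).OrdConnected :=
      ⟨fun x hx z hz y hy => hconv x y z hy.1 hy.2 hx hz⟩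
    exact ⟨Set.range (fixBelow f), fun x hx y hyx => isLowerSet_range_fixBelow f hf hyx hx,
      fun h => notMem_range_fixBelow hm (h ▸ Set.mem_univ m),
      ⟨(strictMono_fixBelow f).orderIso _⟩⟩
end

section
/- Right compressibility is invariant under convex biembeddability: if L is a right compressible linear order and L' is a linear order with L' ⊴ L and L ⊴ L' (i.e. L and L' are convexly biembeddable), then L' is right compressible as well. -/
/-- Convex embeddability between linear orders: an order embedding whose range
is convex. -/
def CvxEmbT (α β : Type*) [LinearOrder α] [LinearOrder β] : Prop :=
  ∃ f : α ↪o β, ∀ x y z : β, x ≤ y → y ≤ z →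
    x ∈ Set.range f → z ∈ Set.range f → y ∈ Set.range f

theorem RightCompressible.of_strictMono {α : Type*} [LinearOrder α] {f : α → α}
    (hf : StrictMono f) (hlow : IsLowerSet (Set.range f)) {q : α} (hq : q ∉ Set.range f) :
    RightCompressible α :=
  ⟨Set.range f, fun _ hx _ hyx => hlow hyx hx, fun h => hq (h ▸ Set.mem_univ q),
    ⟨hf.orderIso f⟩⟩

/-- A linear order is right compressible as soon as it has a convex self-embedding `φ` whose
range is strictly bounded above: being the identity on the points lying to the left of the range
of some iterate of `φ`, and `φ` elsewhere, gives an embedding onto a proper initial segment. -/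
theorem RightCompressible.of_convex_of_forall_lt {α : Type*} [LinearOrder α] {φ : α → α}
    (hφ : StrictMono φ) (hconv : (Set.range φ).OrdConnected) {q : α} (hq : ∀ x, φ x < q) :
    RightCompressible α := by
  classical
  let I : Set α := {x | ∃ n : ℕ, ∀ y, x < φ^[n] y}
  have hIlow : ∀ x ∈ I, ∀ y, y ≤ x → y ∈ I := fun x ⟨n, hn⟩ y hyx =>
    ⟨n, fun z => hyx.trans_lt (hn z)⟩
  have hIφ : ∀ x, φ x ∈ I ↔ x ∈ I := by
    refine fun x => ⟨fun ⟨n, hn⟩ => ?_, fun ⟨n, hn⟩ => ⟨n + 1, fun y => ?_⟩⟩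
    · cases n with
      | zero => exact absurd (hn (φ x)) (lt_irrefl _)
      | succ m =>
        refine ⟨m, fun y => ?_⟩
        have := hn y
        rw [Function.iterate_succ_apply'] at this
        exact hφ.lt_iff_lt.1 this
    · rw [Function.iterate_succ_apply']
      exact hφ (hn y)
  have hqI : q ∉ I := by
    rintro ⟨n, hn⟩
    have := hn q
    cases n with
    | zero => exact lt_irrefl _ this
    | succ m =>
      rw [Function.iterate_succ_apply'] at this
      exact lt_asymm this (hq _)
  have hlt : ∀ x ∈ I, ∀ y ∉ I, x < y := fun x hx y hy =>
    lt_of_not_ge fun h => hy (hIlow x hx y h)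
  refine .of_strictMono (f := fun x => if x ∈ I then x else φ x) (q := q) ?_ ?_ ?_
  · intro x y hxy
    by_cases hy : y ∈ I
    · simpa [hy, hIlow y hy x hxy.le] using hxy
    · by_cases hx : x ∈ I
      · simpa [hx, hy] using hlt x hx _ (mt (hIφ y).1 hy)
      · simpa [hx, hy] using hφ hxy
  · rintro _ z hz ⟨y, rfl⟩
    by_cases hzI : z ∈ I
    · exact ⟨z, if_pos hzI⟩
    have hy : y ∉ I := fun hy => hzI (hIlow y hy z (by simpa [hy] using hz))
    obtain ⟨w, hw⟩ : ∃ w, φ w ≤ z := by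
      by_contra! h
      exact hzI ⟨1, h⟩
    obtain ⟨u, rfl⟩ := hconv.out ⟨w, rfl⟩ ⟨y, rfl⟩ ⟨hw, by simpa [hy] using hz⟩
    exact ⟨u, if_neg (mt (hIφ u).2 hzI)⟩
  · rintro ⟨x, hx⟩
    by_cases hxI : x ∈ I
    · simp only [if_pos hxI] at hx
      exact hqI (hx ▸ hxI)
    · simp only [if_neg hxI] at hx
      exact (hq x).ne hx

/-- An order having a right compressible final segment is right compressible. -/
theorem RightCompressible.of_isUpperSet_range {α β : Type*} [LinearOrder α] [LinearOrder β]
    (hα : RightCompressible α) (k : α ↪o β) (hk : IsUpperSet (Set.range k)) :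
    RightCompressible β := by
  classical
  obtain ⟨S, hS, hne, ⟨e⟩⟩ := hα
  obtain ⟨q, hq⟩ := (Set.ne_univ_iff_exists_notMem S).1 hne
  let f : β → β := fun x => if h : x ∈ Set.range k then k (e h.choose) else x
  have hfk : ∀ a, f (k a) = k (e a) := fun a => by
    have h : k a ∈ Set.range k := ⟨a, rfl⟩
    have : h.choose = a := k.injective h.choose_spec
    simp only [f, dif_pos h, this]
  have hf : ∀ x, x ∉ Set.range k → f x = x := fun x hx => dif_neg hx
  refine .of_strictMono (f := f) (q := k q) ?_ ?_ ?_
  · intro x y hxy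
    by_cases hx : x ∈ Set.range k
    · obtain ⟨b, rfl⟩ := hk hxy.le hx
      obtain ⟨a, rfl⟩ := hx
      rw [hfk, hfk]
      exact k.lt_iff_lt.2 (e.strictMono (k.lt_iff_lt.1 hxy))
    · rw [hf x hx]
      by_cases hy : y ∈ Set.range k
      · obtain ⟨b, rfl⟩ := hy
        rw [hfk]
        exact lt_of_not_ge fun h => hx (hk h ⟨_, rfl⟩)
      · rwa [hf y hy]
  · rintro _ z hz ⟨y, rfl⟩
    by_cases hzk : z ∈ Set.range k
    · obtain ⟨c, rfl⟩ := hzk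
      obtain ⟨b, rfl⟩ : y ∈ Set.range k := by
        by_contra hy
        rw [hf y hy] at hz
        exact hy (hk hz ⟨c, rfl⟩)
      rw [hfk, k.le_iff_le] at hz
      refine ⟨k (e.symm ⟨c, hS _ (e b).2 c hz⟩), ?_⟩
      rw [hfk, e.apply_symm_apply]
    · exact ⟨z, hf z hzk⟩
  · rintro ⟨x, hx⟩
    by_cases hxk : x ∈ Set.range k
    · obtain ⟨a, rfl⟩ := hxk
      rw [hfk] at hx
      exact hq (k.injective hx ▸ (e a).2)
    · rw [hf x hxk] at hx
      exact hxk ⟨q, hx.symm⟩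

/-- Right compressibility is invariant under convex biembeddability. -/
theorem rightCompressible_of_cvxBiembeddable (α β : Type*)
    [LinearOrder α] [LinearOrder β]
    (hα : RightCompressible α) (h₁ : CvxEmbT β α) (h₂ : CvxEmbT α β) :
    RightCompressible β := by
  obtain ⟨h, hh⟩ := h₁
  obtain ⟨k, hk⟩ := h₂
  by_cases hq : ∃ q, ∀ a, k a < q
  · obtain ⟨q, hq⟩ := hq
    refine .of_convex_of_forall_lt (φ := k ∘ h) (k.strictMono.comp h.strictMono) ⟨?_⟩
      (fun x => hq (h x))
    rintro _ ⟨x, rfl⟩ _ ⟨z, rfl⟩ y ⟨hxy, hyz⟩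
    obtain ⟨a, rfl⟩ := hk _ y _ hxy hyz ⟨_, rfl⟩ ⟨_, rfl⟩
    obtain ⟨b, rfl⟩ := hh _ a _ (k.le_iff_le.1 hxy) (k.le_iff_le.1 hyz) ⟨x, rfl⟩ ⟨z, rfl⟩
    exact ⟨b, rfl⟩
  · push Not at hq
    refine hα.of_isUpperSet_range k fun x y hxy hx => ?_
    obtain ⟨a, ha⟩ := hq y
    exact hk x y _ hxy ha hx ⟨a, rfl⟩
end

section
/- On incompressible linear orders on ℕ, convex biembeddability coincides with isomorphism: if L and L' are linear orders on ℕ, neither of which is left compressible or right compressible, then L and L' are convexly biembeddable if and only if L is order-isomorphic to L'. -/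
/-- A linear order `L` on `ℕ` is right compressible if some proper initial
segment of `L` is order-isomorphic to `L`: here witnessed by a self-embedding
`f` whose range is a downward-closed proper subset. -/
def RightCompr (L : LinearOrder ℕ) : Prop :=
  ∃ f : ℕ → ℕ, (∀ a b : ℕ, L.le a b ↔ L.le (f a) (f b)) ∧
    (∀ x y : ℕ, x ∈ Set.range f → L.le y x → y ∈ Set.range f) ∧
    Set.range f ≠ Set.univ

/-- A linear order `L` on `ℕ` is left compressible if some proper final
segment of `L` is order-isomorphic to `L`. -/
def LeftCompr (L : LinearOrder ℕ) : Prop :=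
  ∃ f : ℕ → ℕ, (∀ a b : ℕ, L.le a b ↔ L.le (f a) (f b)) ∧
    (∀ x y : ℕ, x ∈ Set.range f → L.le x y → y ∈ Set.range f) ∧
    Set.range f ≠ Set.univ

open Set

/-- If a convex self-embedding `h` has a strict lower bound `a` of its range, then some proper final
segment is isomorphic to the whole order: apply `h` below the orbit of `a` and fix everything
else. -/
theorem exists_embedding_isUpperSet_of_convex {α : Type*} [LinearOrder α] (h : α ↪o α)
    (hc : ∀ x y z, x ≤ y → y ≤ z → x ∈ range h → z ∈ range h → y ∈ range h)
    (a : α) (ha : ∀ x, a < h x) :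
    ∃ g : α → α, (∀ x y, x ≤ y ↔ g x ≤ g y) ∧
      (∀ x y, x ∈ range g → x ≤ y → y ∈ range g) ∧ range g ≠ univ := by
  classical
  let P : α → Prop := fun x => ∃ n : ℕ, x ≤ h^[n] a
  have down : ∀ {x y}, x ≤ y → P y → P x := fun hxy ⟨n, hn⟩ => ⟨n, hxy.trans hn⟩
  have step : ∀ {x}, P x → P (h x) := fun ⟨n, hn⟩ =>
    ⟨n + 1, by rw [Function.iterate_succ_apply']; exact h.le_iff_le.2 hn⟩
  have lt_of : ∀ {x y}, P x → ¬ P y → x < y := fun hx hy =>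
    lt_of_not_ge fun hyx => hy (down hyx hx)
  let g : α → α := fun x => if P x then h x else x
  have gpos : ∀ {x}, P x → g x = h x := fun hx => if_pos hx
  have gneg : ∀ {x}, ¬ P x → g x = x := fun hx => if_neg hx
  refine ⟨g, fun x y => ?_, ?_, fun hu => ?_⟩
  · by_cases hx : P x <;> by_cases hy : P y
    · rw [gpos hx, gpos hy, h.le_iff_le]
    · rw [gpos hx, gneg hy]
      exact iff_of_true (lt_of hx hy).le (lt_of (step hx) hy).le
    · rw [gneg hx, gpos hy]
      exact iff_of_false (lt_of hy hx).not_ge (lt_of (step hy) hx).not_ge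
    · rw [gneg hx, gneg hy]
  · rintro _ y ⟨x, rfl⟩ hxy
    by_cases hy : P y
    · by_cases hx : P x
      · rw [gpos hx] at hxy
        obtain ⟨n, hn⟩ := hy
        cases n with
        | zero => exact absurd (hxy.trans hn) (ha x).not_ge
        | succ n =>
          rw [Function.iterate_succ_apply'] at hn
          obtain ⟨z, rfl⟩ := hc _ _ _ hxy hn ⟨x, rfl⟩ ⟨_, rfl⟩
          exact ⟨z, gpos ⟨n, h.le_iff_le.1 hn⟩⟩
      · rw [gneg hx] at hxy
        exact absurd (down hxy hy) hx
    · exact ⟨y, gneg hy⟩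
  · obtain ⟨x, hx⟩ : a ∈ range g := hu ▸ mem_univ a
    by_cases hP : P x
    · rw [gpos hP] at hx
      exact (ha x).ne' hx
    · rw [gneg hP] at hx
      exact hP ⟨0, hx.le⟩

/-- Every convex self-embedding of an incompressible linear order on `ℕ` is surjective. -/
theorem surjective_of_convex_of_incompressible (L : LinearOrder ℕ)
    (hl : ¬ LeftCompr L) (hr : ¬ RightCompr L) (h : ℕ → ℕ)
    (hle : ∀ a b, L.le a b ↔ L.le (h a) (h b))
    (hc : ∀ x y z, L.le x y → L.le y z → x ∈ range h → z ∈ range h → y ∈ range h) :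
    Function.Surjective h := by
  intro a
  by_contra hna
  rcases L.le_total a (h 0) with h0 | h0
  · refine hl (@exists_embedding_isUpperSet_of_convex ℕ L
      (@OrderEmbedding.ofMapLEIff ℕ ℕ L.toPartialOrder L.toPreorder h
        fun x y => (hle x y).symm) hc a fun x => ?_)
    refine (@lt_iff_not_ge ℕ L _ _).2 fun hx => hna ?_
    exact hc _ _ _ hx h0 ⟨x, rfl⟩ ⟨0, rfl⟩
  · let D : LinearOrder ℕ := @OrderDual.instLinearOrder ℕ L
    obtain ⟨g, hg, hup, hu⟩ := @exists_embedding_isUpperSet_of_convex ℕ D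
      (@OrderEmbedding.ofMapLEIff ℕ ℕ D.toPartialOrder D.toPreorder h
        fun x y => (hle y x).symm) (fun x y z hxy hyz hx hz => hc z y x hyz hxy hz hx) a
      fun x => (@lt_iff_not_ge ℕ D _ _).2 fun hx => hna (hc _ _ _ h0 hx ⟨0, rfl⟩ ⟨x, rfl⟩)
    exact hr ⟨g, fun x y => hg y x, hup, hu⟩

/-- On incompressible linear orders on `ℕ`, convex biembeddability coincides
with isomorphism. -/
theorem cvxBiembed_iff_iso_of_incompressible (L L' : LinearOrder ℕ)
    (h₁ : ¬ LeftCompr L) (h₂ : ¬ RightCompr L)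
    (h₁' : ¬ LeftCompr L') (h₂' : ¬ RightCompr L') :
    (CvxEmb L L' ∧ CvxEmb L' L) ↔ IsoNat L L' := by
  constructor
  · rintro ⟨⟨f, hf, hfc⟩, ⟨g, hg, hgc⟩⟩
    have hsurj : Function.Surjective (g ∘ f) := by
      refine surjective_of_convex_of_incompressible L h₁ h₂ _
        (fun a b => (hf a b).trans (hg _ _)) ?_
      rintro _ y _ hxy hyz ⟨x, rfl⟩ ⟨z, rfl⟩
      obtain ⟨w, rfl⟩ := hgc _ _ _ hxy hyz ⟨_, rfl⟩ ⟨_, rfl⟩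
      obtain ⟨v, rfl⟩ := hfc _ _ _ ((hg _ _).2 hxy) ((hg _ _).2 hyz) ⟨x, rfl⟩ ⟨z, rfl⟩
      exact ⟨v, rfl⟩
    have hinj : Function.Injective g := fun a b hab =>
      L'.le_antisymm a b ((hg a b).2 (hab ▸ L.le_refl _)) ((hg b a).2 (hab ▸ L.le_refl _))
    let e : ℕ ≃ ℕ := Equiv.ofBijective g ⟨hinj, hsurj.of_comp⟩
    refine ⟨e.symm, fun a b => ?_⟩
    have hab := hg (e.symm a) (e.symm b)
    rwa [show g (e.symm a) = a from e.apply_symm_apply a,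
      show g (e.symm b) = b from e.apply_symm_apply b, Iff.comm] at hab
  · rintro ⟨e, he⟩
    refine ⟨⟨e, he, fun _ y _ _ _ _ _ => e.surjective y⟩,
      ⟨e.symm, fun a b => ?_, fun _ y _ _ _ _ _ => e.symm.surjective y⟩⟩
    rw [he, e.apply_symm_apply, e.apply_symm_apply]
end

section
/- Let L and L' be linear orders on ℕ that are both left compressible and right compressible. Then L and L' are convexly biembeddable if and only if: for all a ≤_L b such that the closed interval [a,b]_L is infinite there exist a' ≤_{L'} b' with [a,b]_L order-isomorphic to [a',b']_{L'}, and for all a' ≤_{L'} b' such that [a',b']_{L'} is infinite there exist a ≤_L b with [a',b']_{L'} order-isomorphic to [a,b]_L. -/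
/-- The subset `S` of `ℕ` ordered by `L` is order-isomorphic to the subset `T`
of `ℕ` ordered by `L'`. -/
def IsoOn (L L' : LinearOrder ℕ) (S T : Set ℕ) : Prop :=
  ∃ g : S ≃ T, ∀ x y : S, L.le x.1 y.1 ↔ L'.le (g x).1 (g y).1

/-- The closed interval `[a,b]` of the linear order `L` on `ℕ`. -/
def IccL (L : LinearOrder ℕ) (a b : ℕ) : Set ℕ := {x | L.le a x ∧ L.le x b}

theorem injective_of_le_iff {L L' : LinearOrder ℕ} {f : ℕ → ℕ}
    (hf : ∀ a b : ℕ, L.le a b ↔ L'.le (f a) (f b)) : Function.Injective f := fun a b h =>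
  L.le_antisymm a b ((hf a b).2 (h ▸ L'.le_refl _)) ((hf b a).2 (h ▸ L'.le_refl _))

/-- A convex embedding maps closed intervals isomorphically onto closed intervals. -/
theorem CvxEmb.exists_isoOn_IccL {L L' : LinearOrder ℕ} (h : CvxEmb L L') {a b : ℕ}
    (hab : L.le a b) :
    ∃ a' b' : ℕ, L'.le a' b' ∧ IsoOn L L' (IccL L a b) (IccL L' a' b') := by
  obtain ⟨f, hf, hconv⟩ := h
  refine ⟨f a, f b, (hf a b).1 hab, ?_⟩
  let g : IccL L a b → IccL L' (f a) (f b) := fun x =>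
    ⟨f x.1, (hf _ _).1 x.2.1, (hf _ _).1 x.2.2⟩
  have hg : Function.Bijective g := by
    constructor
    · intro x y hxy
      exact Subtype.ext (injective_of_le_iff hf (congrArg Subtype.val hxy))
    · rintro ⟨y, hay, hyb⟩
      obtain ⟨x, rfl⟩ := hconv _ _ _ hay hyb ⟨a, rfl⟩ ⟨b, rfl⟩
      exact ⟨⟨x, (hf _ _).2 hay, (hf _ _).2 hyb⟩, rfl⟩
  exact ⟨Equiv.ofBijective g hg, fun x y => hf x.1 y.1⟩

/-- A left and right compressible order convexly embeds into one of its own closed intervals. -/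
theorem exists_cvxEmb_into_IccL {L : LinearOrder ℕ} (hl : LeftCompr L) (hr : RightCompr L) :
    ∃ (a b : ℕ) (f : ℕ → ℕ), (∀ x y : ℕ, L.le x y ↔ L.le (f x) (f y)) ∧
      (∀ x y z : ℕ, L.le x y → L.le y z →
        x ∈ Set.range f → z ∈ Set.range f → y ∈ Set.range f) ∧
      ∀ x, f x ∈ IccL L a b := by
  obtain ⟨g, hg, hgup, hgne⟩ := hl
  obtain ⟨f, hf, hfdown, hfne⟩ := hr
  obtain ⟨a, ha⟩ := (Set.ne_univ_iff_exists_notMem _).1 hgne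
  obtain ⟨b, hb⟩ := (Set.ne_univ_iff_exists_notMem _).1 hfne
  refine ⟨f a, b, f ∘ g, fun x y => (hg x y).trans (hf _ _), ?_, fun x => ⟨?_, ?_⟩⟩
  · rintro _ y _ hxy hyz ⟨x, rfl⟩ ⟨z, rfl⟩
    obtain ⟨w, rfl⟩ := hfdown _ y ⟨g z, rfl⟩ hyz
    obtain ⟨v, rfl⟩ := hgup _ w ⟨x, rfl⟩ ((hf _ _).2 hxy)
    exact ⟨v, rfl⟩
  · exact (hf _ _).1 ((L.le_total _ _).resolve_right fun h => ha (hgup _ _ ⟨x, rfl⟩ h))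
  · exact (L.le_total _ _).resolve_right fun h => hb (hfdown _ _ ⟨g x, rfl⟩ h)

/-- If every infinite closed interval of a left and right compressible order `L` is isomorphic to
a closed interval of `L'`, then `L` convexly embeds into `L'`. -/
theorem cvxEmb_of_forall_exists_isoOn_IccL {L L' : LinearOrder ℕ}
    (hl : LeftCompr L) (hr : RightCompr L)
    (h : ∀ a b : ℕ, L.le a b → (IccL L a b).Infinite →
      ∃ a' b' : ℕ, L'.le a' b' ∧ IsoOn L L' (IccL L a b) (IccL L' a' b')) :
    CvxEmb L L' := by
  obtain ⟨a, b, f, hf, hconv, hmem⟩ := exists_cvxEmb_into_IccL hl hr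
  obtain ⟨a', b', -, g, hg⟩ := h a b (L.le_trans _ _ _ (hmem 0).1 (hmem 0).2)
    (Set.infinite_of_injective_forall_mem (injective_of_le_iff hf) hmem)
  refine ⟨fun x => (g ⟨f x, hmem x⟩).1, fun x y => (hf x y).trans (hg ⟨f x, hmem x⟩ ⟨f y, hmem y⟩), ?_⟩
  rintro _ y _ hxy hyz ⟨x, rfl⟩ ⟨z, rfl⟩
  obtain ⟨⟨w, hw⟩, hwy⟩ := g.surjective ⟨y, L'.le_trans _ _ _ (g ⟨f x, hmem x⟩).2.1 hxy,
    L'.le_trans _ _ _ hyz (g ⟨f z, hmem z⟩).2.2⟩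
  obtain rfl : (g ⟨w, hw⟩).1 = y := congrArg Subtype.val hwy
  obtain ⟨v, rfl⟩ := hconv _ w _ ((hg ⟨f x, hmem x⟩ ⟨w, hw⟩).2 hxy)
    ((hg ⟨w, hw⟩ ⟨f z, hmem z⟩).2 hyz) ⟨x, rfl⟩ ⟨z, rfl⟩
  exact ⟨v, rfl⟩

/-- For `L, L'` both left and right compressible linear orders on `ℕ`:
`L` and `L'` are convexly biembeddable iff every infinite closed interval of
either is order-isomorphic to a closed interval of the other. -/
theorem cvxBiembed_iff_intervals_of_biCompressible (L L' : LinearOrder ℕ)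
    (hl : LeftCompr L) (hr : RightCompr L)
    (hl' : LeftCompr L') (hr' : RightCompr L') :
    (CvxEmb L L' ∧ CvxEmb L' L) ↔
      ((∀ a b : ℕ, L.le a b → (IccL L a b).Infinite →
          ∃ a' b' : ℕ, L'.le a' b' ∧ IsoOn L L' (IccL L a b) (IccL L' a' b')) ∧
       (∀ a' b' : ℕ, L'.le a' b' → (IccL L' a' b').Infinite →
          ∃ a b : ℕ, L.le a b ∧ IsoOn L' L (IccL L' a' b') (IccL L a b))) := by
  exact ⟨fun h => ⟨fun _ _ hab _ => h.1.exists_isoOn_IccL hab,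
      fun _ _ hab _ => h.2.exists_isoOn_IccL hab⟩,
    fun h => ⟨cvxEmb_of_forall_exists_isoOn_IccL hl hr h.1,
      cvxEmb_of_forall_exists_isoOn_IccL hl' hr' h.2⟩⟩
end

section
/- Let L and L' be linear orders on ℕ that are left compressible but not right compressible. Then L and L' are convexly biembeddable if and only if: for every a ∈ L such that the final segment [a,∞)_L is infinite there exists a' ∈ L' with [a,∞)_L order-isomorphic to [a',∞)_{L'}, and for every a' ∈ L' such that [a',∞)_{L'} is infinite there exists a ∈ L with [a',∞)_{L'} order-isomorphic to [a,∞)_L. -/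
/-- The final segment `[a,∞)` of the linear order `L` on `ℕ`. -/
def IciL (L : LinearOrder ℕ) (a : ℕ) : Set ℕ := {x | L.le a x}

/-- A convex self-embedding whose range is not an upper set can be modified, on the upper set
generated by the iterated images of the points above the range, into an embedding onto a proper
initial segment. -/
theorem exists_proper_initial_embedding {α : Type*} [LinearOrder α] {h : α → α}
    (h_le : ∀ a b, a ≤ b ↔ h a ≤ h b)
    (h_cvx : ∀ x y z, x ≤ y → y ≤ z → x ∈ Set.range h → z ∈ Set.range h → y ∈ Set.range h)
    {x y : α} (hx : x ∈ Set.range h) (hxy : x ≤ y) (hy : y ∉ Set.range h) :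
    ∃ k : α → α, (∀ a b, a ≤ b ↔ k a ≤ k b) ∧
      (∀ x y, x ∈ Set.range k → y ≤ x → y ∈ Set.range k) ∧ Set.range k ≠ Set.univ := by
  classical
  let B : Set α := {z | ∀ w, h w < z}
  let U : Set α := {z | ∃ n, ∃ b ∈ B, h^[n] b ≤ z}
  let k : α → α := fun z => if z ∈ U then h z else z
  have h_strict : StrictMono h := strictMono_of_le_iff_le h_le
  have hyB : y ∈ B := fun w => by
    by_contra hw
    exact hy (h_cvx x y (h w) hxy (not_lt.mp hw) hx ⟨w, rfl⟩)
  have h_mem {z : α} (hz : z ∈ U) : h z ∈ U := by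
    obtain ⟨n, b, hb, hbz⟩ := hz
    exact ⟨n + 1, b, hb, by
      rw [Function.iterate_succ_apply']
      exact (h_le _ _).mp hbz⟩
  have U_upper {z w : α} (hz : z ∈ U) (hzw : z ≤ w) : w ∈ U := by
    obtain ⟨n, b, hb, hbz⟩ := hz
    exact ⟨n, b, hb, hbz.trans hzw⟩
  have B_sub {z : α} (hz : z ∈ B) : z ∈ U := ⟨0, z, hz, le_rfl⟩
  have k_strict : StrictMono k := by
    intro a b hab
    by_cases ha : a ∈ U
    · simpa [k, ha, U_upper ha hab.le] using h_strict hab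
    · by_cases hb : b ∈ U
      · simp only [k, ha, hb, if_true, if_false]
        by_contra hba
        exact ha (U_upper (h_mem hb) (not_lt.mp hba))
      · simpa [k, ha, hb] using hab
  have k_notMem (z : α) : k z ∉ B := by
    by_cases hz : z ∈ U
    · simp only [k, hz, if_true]
      exact fun hB => lt_irrefl _ (hB z)
    · simp only [k, hz, if_false]
      exact fun hB => hz (B_sub hB)
  have mem_range_k {z : α} (hz : z ∉ B) : z ∈ Set.range k := by
    by_cases hzU : z ∈ U
    · obtain ⟨w, hw⟩ : ∃ w, z ≤ h w := by simpa [B] using hz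
      obtain ⟨n, b, hb, hbz⟩ := hzU
      cases n with
      | zero => exact absurd (hb w) (not_lt.mpr (hbz.trans hw))
      | succ m =>
        rw [Function.iterate_succ_apply'] at hbz
        obtain ⟨v, rfl⟩ := h_cvx _ z _ hbz hw ⟨_, rfl⟩ ⟨_, rfl⟩
        have hv : v ∈ U := ⟨m, b, hb, (h_le _ _).mpr hbz⟩
        exact ⟨v, by simp [k, hv]⟩
    · exact ⟨z, by simp [k, hzU]⟩
  refine ⟨k, fun a b => k_strict.le_iff_le.symm, ?_, fun hk => ?_⟩
  · rintro _ z ⟨v, rfl⟩ hz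
    exact mem_range_k fun hB => k_notMem v fun w => (hB w).trans_le hz
  · obtain ⟨z, hz⟩ : y ∈ Set.range k := hk ▸ Set.mem_univ y
    exact k_notMem z (hz ▸ hyB)

theorem isoOn_finalSegment_of_cvxEmb {L L' : LinearOrder ℕ} (hr : ¬ RightCompr L)
    (hLL' : CvxEmb L L') (hL'L : CvxEmb L' L) (a : ℕ) :
    ∃ a', IsoOn L L' (IciL L a) (IciL L' a') := by
  obtain ⟨f, hf, f_cvx⟩ := hLL'
  obtain ⟨g, hg, g_cvx⟩ := hL'L
  have g_inj : Function.Injective g := fun u v huv =>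
    L'.le_antisymm _ _ ((hg u v).mpr (huv ▸ L.le_refl _)) ((hg v u).mpr (huv ▸ L.le_refl _))
  have f_inj : Function.Injective f := fun u v huv =>
    L.le_antisymm _ _ ((hf u v).mpr (huv ▸ L'.le_refl _)) ((hf v u).mpr (huv ▸ L'.le_refl _))
  have f_upper (x y : ℕ) (hxy : L'.le (f x) y) : y ∈ Set.range f := by
    by_contra hy
    refine hr (@exists_proper_initial_embedding ℕ L (g ∘ f)
      (fun u v => (hf u v).trans (hg _ _)) ?_ (g (f x)) (g y) ⟨x, rfl⟩ ((hg _ _).mp hxy) ?_)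
    · rintro _ v _ huv hvw ⟨u, rfl⟩ ⟨w, rfl⟩
      obtain ⟨v, rfl⟩ := g_cvx _ v _ huv hvw ⟨_, rfl⟩ ⟨_, rfl⟩
      obtain ⟨v, rfl⟩ := f_cvx _ v _ ((hg _ _).mpr huv) ((hg _ _).mpr hvw) ⟨_, rfl⟩ ⟨_, rfl⟩
      exact ⟨v, rfl⟩
    · rintro ⟨u, hu⟩
      exact hy ⟨u, g_inj hu⟩
  refine ⟨f a, Equiv.ofBijective (fun x => ⟨f x.1, (hf _ _).mp x.2⟩) ⟨?_, ?_⟩,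
    fun x y => hf x.1 y.1⟩
  · exact fun u v huv => Subtype.ext (f_inj (congrArg Subtype.val huv))
  · rintro ⟨y, hy⟩
    obtain ⟨x, rfl⟩ := f_upper a y hy
    exact ⟨⟨x, (hf _ _).mpr hy⟩, rfl⟩

theorem cvxEmb_of_isoOn_finalSegments {L L' : LinearOrder ℕ} (hl : LeftCompr L)
    (h : ∀ a, (IciL L a).Infinite → ∃ a', IsoOn L L' (IciL L a) (IciL L' a')) :
    CvxEmb L L' := by
  obtain ⟨f, hf, f_upper, f_ne⟩ := hl
  obtain ⟨c, hc⟩ := (Set.ne_univ_iff_exists_notMem _).mp f_ne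
  have f_inj : Function.Injective f := fun u v huv =>
    L.le_antisymm _ _ ((hf u v).mpr (huv ▸ L.le_refl _)) ((hf v u).mpr (huv ▸ L.le_refl _))
  have c_le (x : ℕ) : L.le c (f x) :=
    (L.le_total c (f x)).resolve_right fun hxc => hc (f_upper _ _ ⟨x, rfl⟩ hxc)
  obtain ⟨c', g, hg⟩ := h c ((Set.infinite_range_of_injective f_inj).mono
    (Set.range_subset_iff.mpr c_le))
  refine ⟨fun x => (g ⟨f x, c_le x⟩).1, fun a b => (hf a b).trans (hg ⟨f a, c_le a⟩ ⟨f b, c_le b⟩), ?_⟩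
  rintro _ y _ huy - ⟨u, rfl⟩ -
  obtain ⟨⟨z, hz⟩, hgz⟩ := g.surjective ⟨y, L'.le_trans _ _ _ (g ⟨f u, c_le u⟩).2 huy⟩
  obtain rfl : (g ⟨z, hz⟩).1 = y := congrArg Subtype.val hgz
  obtain ⟨x, rfl⟩ := f_upper _ z ⟨u, rfl⟩ ((hg ⟨f u, c_le u⟩ ⟨z, hz⟩).mpr huy)
  exact ⟨x, rfl⟩

/-- For `L, L'` left compressible but not right compressible linear orders on
`ℕ`: `L` and `L'` are convexly biembeddable iff every infinite final segment
`[a,∞)` of either is order-isomorphic to a final segment of the other. -/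
theorem cvxBiembed_iff_finalSegments_of_leftCompressible (L L' : LinearOrder ℕ)
    (hl : LeftCompr L) (hr : ¬ RightCompr L)
    (hl' : LeftCompr L') (hr' : ¬ RightCompr L') :
    (CvxEmb L L' ∧ CvxEmb L' L) ↔
      ((∀ a : ℕ, (IciL L a).Infinite →
          ∃ a' : ℕ, IsoOn L L' (IciL L a) (IciL L' a')) ∧
       (∀ a' : ℕ, (IciL L' a').Infinite →
          ∃ a : ℕ, IsoOn L' L (IciL L' a') (IciL L a))) := by
  refine ⟨fun ⟨h, h'⟩ => ⟨fun a _ => isoOn_finalSegment_of_cvxEmb hr h h' a,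
    fun a' _ => isoOn_finalSegment_of_cvxEmb hr' h' h a'⟩,
    fun ⟨h, h'⟩ => ⟨cvxEmb_of_isoOn_finalSegments hl h, cvxEmb_of_isoOn_finalSegments hl' h'⟩⟩
end

section
/- Let α be a type equipped with a circular order and let A, B ⊆ α be convex subsets. Then A ∩ B is the union of two convex subsets of α. Moreover, if A ∩ B is not convex, then A ∪ B = α. -/
/-- Convexity of a subset of a circular order. -/
def CircConvex {α : Type*} [CircularOrder α] (A : Set α) : Prop :=
  ∀ x ∈ A, ∀ y ∈ A, x ≠ y →
    (∀ c, btw x c y → c ∈ A) ∨ (∀ c, btw y c x → c ∈ A)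

section CircularOrder

variable {α : Type*} [CircularOrder α]

theorem sbtw_or_sbtw_of_ne {a b c : α} (hab : a ≠ b) (hbc : b ≠ c) (hca : c ≠ a) :
    sbtw a b c ∨ sbtw c b a := by
  by_contra! h
  rcases (btw_iff_not_sbtw.2 h.2).antisymm (btw_iff_not_sbtw.2 h.1) with h | h | h <;> contradiction

theorem btw_iff_eq_or_eq_or_sbtw {x y c : α} (hxy : x ≠ y) :
    btw x c y ↔ c = x ∨ c = y ∨ sbtw x c y := by
  constructor
  · intro h
    by_contra! hc
    rcases sbtw_or_sbtw_of_ne hc.1.symm hc.2.1 hxy.symm with h' | h'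
    · exact hc.2.2 h'
    · exact h'.not_btw h
  · rintro (rfl | rfl | h)
    exacts [btw_rfl_left, btw_rfl_right, h.btw]

/-- Convexity can be tested on open arcs. -/
theorem circConvex_iff_sbtw {A : Set α} :
    CircConvex A ↔ ∀ x ∈ A, ∀ y ∈ A,
      (∀ c, sbtw x c y → c ∈ A) ∨ (∀ c, sbtw y c x → c ∈ A) := by
  refine ⟨fun h x hx y hy => ?_, fun h x hx y hy hxy => ?_⟩
  · by_cases hxy : x = y
    · subst hxy
      exact Or.inl fun c hc => (sbtw_irrefl_left_right hc).elim
    · exact (h x hx y hy hxy).imp (fun h c hc => h c hc.btw) (fun h c hc => h c hc.btw)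
  · refine (h x hx y hy).imp (fun h c hc => ?_) (fun h c hc => ?_)
    · rcases (btw_iff_eq_or_eq_or_sbtw hxy).1 hc with rfl | rfl | hc
      exacts [hx, hy, h c hc]
    · rcases (btw_iff_eq_or_eq_or_sbtw hxy.symm).1 hc with rfl | rfl | hc
      exacts [hy, hx, h c hc]

/-- A convex set missing a point of one open arc contains the opposite open arc. -/
theorem CircConvex.mem_of_sbtw {A : Set α} (hA : CircConvex A) {x y d c : α}
    (hx : x ∈ A) (hy : y ∈ A) (hd : d ∉ A) (hyd : sbtw y d x) (hc : sbtw x c y) : c ∈ A :=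
  (circConvex_iff_sbtw.1 hA x hx y hy).elim (fun h => h c hc) fun h => (hd (h d hyd)).elim

/-- Two convex sets meet in a convex set inside an open arc whose left endpoint is missing from
the first set and whose right endpoint is missing from the second. -/
theorem CircConvex.inter_inter_cIoo {A B : Set α} (hA : CircConvex A) (hB : CircConvex B)
    {d c : α} (hd : d ∉ A) (hc : c ∉ B) : CircConvex (A ∩ B ∩ Set.cIoo d c) := by
  have key : ∀ x ∈ A ∩ B ∩ Set.cIoo d c, ∀ y ∈ A ∩ B ∩ Set.cIoo d c, sbtw d x y →
      ∀ e, sbtw x e y → e ∈ A ∩ B ∩ Set.cIoo d c := by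
    rintro x ⟨⟨hxA, hxB⟩, hx⟩ y ⟨⟨hyA, hyB⟩, hy⟩ hxy e he
    rw [Set.mem_cIoo] at hx hy
    have hyc : sbtw y c x := hy.cyclic_left.trans_right hxy.cyclic_right
    exact ⟨⟨hA.mem_of_sbtw hxA hyA hd hxy.cyclic_right he, hB.mem_of_sbtw hxB hyB hc hyc he⟩,
      (hxy.trans_left he).trans_right hy⟩
  rw [circConvex_iff_sbtw]
  intro x hx y hy
  by_cases hxy : x = y
  · subst hxy
    exact Or.inl fun c hc => (sbtw_irrefl_left_right hc).elim
  · have hdx : d ≠ x := fun h => hd (h ▸ hx.1.1)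
    have hdy : y ≠ d := fun h => hd (h ▸ hy.1.1)
    rcases sbtw_or_sbtw_of_ne hdx hxy hdy with h | h
    · exact Or.inl (key x hx y hy h)
    · exact Or.inr (key y hy x hx h.cyclic_right)

/-- If two convex sets have a non-convex intersection, then they contain complementary arcs with
common endpoints, and neither contains the other. -/
theorem CircConvex.exists_arcs_of_not_inter {A B : Set α} (hA : CircConvex A) (hB : CircConvex B)
    (h : ¬ CircConvex (A ∩ B)) :
    ∃ x y, (∀ e, btw x e y → e ∈ A) ∧ (∀ e, btw y e x → e ∈ B) ∧
      (∃ c ∈ A, c ∉ B) ∧ ∃ d ∈ B, d ∉ A := by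
  unfold CircConvex at h
  push Not at h
  obtain ⟨x, hx, y, hy, hxy, ⟨c, hc, hcS⟩, d, hd, hdS⟩ := h
  have hA' := hA x hx.1 y hy.1 hxy
  have hB' := hB x hx.2 y hy.2 hxy
  rcases hA' with hA' | hA'
  · have hcB : c ∉ B := fun h => hcS ⟨hA' c hc, h⟩
    have hB' := hB'.resolve_left fun h => hcB (h c hc)
    exact ⟨x, y, hA', hB', ⟨c, hA' c hc, hcB⟩, d, hB' d hd, fun h => hdS ⟨h, hB' d hd⟩⟩
  · have hdB : d ∉ B := fun h => hdS ⟨hA' d hd, h⟩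
    have hB' := hB'.resolve_right fun h => hdB (h d hd)
    exact ⟨y, x, hA', hB', ⟨d, hA' d hd, hdB⟩, c, hB' c hc, fun h => hcS ⟨h, hB' c hc⟩⟩

end CircularOrder

/-- The intersection of two convex subsets of a circular order is the union of
two convex subsets; moreover if the intersection is not convex then the union
of the two sets is everything. -/
theorem circConvex_inter {α : Type*} [CircularOrder α] {A B : Set α}
    (hA : CircConvex A) (hB : CircConvex B) :
    (∃ A₁ A₂ : Set α, CircConvex A₁ ∧ CircConvex A₂ ∧ A ∩ B = A₁ ∪ A₂) ∧
    (¬ CircConvex (A ∩ B) → A ∪ B = Set.univ) := by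
  by_cases h : CircConvex (A ∩ B)
  · exact ⟨⟨A ∩ B, A ∩ B, h, h, (Set.union_self _).symm⟩, fun h' => (h' h).elim⟩
  obtain ⟨x, y, hxy, hyx, ⟨c, hcA, hcB⟩, d, -, hd⟩ := hA.exists_arcs_of_not_inter hB h
  refine ⟨⟨A ∩ B ∩ Set.cIoo d c, B ∩ A ∩ Set.cIoo c d, hA.inter_inter_cIoo hB hd hcB,
    hB.inter_inter_cIoo hA hcB hd, ?_⟩, fun _ => ?_⟩
  · rw [Set.inter_comm B A, ← Set.inter_union_distrib_left, eq_comm, Set.inter_eq_left]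
    rintro s ⟨hsA, hsB⟩
    exact sbtw_or_sbtw_of_ne (fun h => hd (h ▸ hsA)) (fun h => hcB (h ▸ hsB))
      (fun h => hd (h ▸ hcA))
  · exact Set.eq_univ_of_forall fun e => (btw_total x e y).imp (hxy e) (hyx e)
end

section
/- Let α be a type equipped with a circular order, and let (A_i)_{i ∈ I} and (B_j)_{j ∈ J} be two families of pairwise disjoint convex subsets of α. Then there is at most one pair (i, j) ∈ I × J such that A_i ∩ B_j is not convex. -/
/-- If two convex sets have a non-convex intersection, then they cover the whole circle. -/
theorem CircConvex.union_eq_univ {α : Type*} [CircularOrder α] {A B : Set α}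
    (hA : CircConvex A) (hB : CircConvex B) (h : ¬ CircConvex (A ∩ B)) : A ∪ B = Set.univ := by
  simp only [CircConvex, not_forall] at h
  obtain ⟨x, ⟨hxA, hxB⟩, y, ⟨hyA, hyB⟩, hxy, h⟩ := h
  rw [Set.eq_univ_iff_forall]
  intro c
  have hc : btw x c y ∨ btw y c x := btw_total x c y
  rcases hA x hxA y hyA hxy with hA | hA <;> rcases hB x hxB y hyB hxy with hB | hB
  · exact absurd (.inl fun c hc => ⟨hA c hc, hB c hc⟩) h
  · exact hc.imp (hA c) (hB c)
  · exact hc.symm.imp (hA c) (hB c)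
  · exact absurd (.inr fun c hc => ⟨hA c hc, hB c hc⟩) h

/-- A convex set whose intersection with another set is non-convex is not contained in it. -/
theorem CircConvex.not_subset {α : Type*} [CircularOrder α] {A B : Set α}
    (hA : CircConvex A) (h : ¬ CircConvex (A ∩ B)) : ¬ A ⊆ B :=
  fun hAB => h (by rwa [Set.inter_eq_left.2 hAB])

/-- Given two families of pairwise disjoint convex subsets of a circular
order, there is at most one pair `(i, j)` such that `A i ∩ B j` is not
convex. -/
theorem circConvex_inter_families {α ι κ : Type*} [CircularOrder α]
    (A : ι → Set α) (B : κ → Set α)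
    (hA : ∀ i, CircConvex (A i)) (hB : ∀ j, CircConvex (B j))
    (hAd : ∀ i i', i ≠ i' → A i ∩ A i' = ∅)
    (hBd : ∀ j j', j ≠ j' → B j ∩ B j' = ∅) :
    ∀ p q : ι × κ, ¬ CircConvex (A p.1 ∩ B p.2) →
      ¬ CircConvex (A q.1 ∩ B q.2) → p = q := by
  rintro ⟨i, j⟩ ⟨i', j'⟩ hp hq
  dsimp only at hp hq
  have cover_q := Set.eq_univ_iff_forall.1 ((hA i').union_eq_univ (hB j') hq)
  have subset_A : j ≠ j' → B j ⊆ A i' := fun hj x hx =>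
    (cover_q x).resolve_right fun hx' => (hBd j j' hj).subset ⟨hx, hx'⟩
  have subset_B : i ≠ i' → A i ⊆ B j' := fun hi x hx =>
    (cover_q x).resolve_left fun hx' => (hAd i i' hi).subset ⟨hx, hx'⟩
  by_cases hi : i = i' <;> by_cases hj : j = j'
  · rw [hi, hj]
  · subst hi
    exact absurd (subset_A hj) ((hB j).not_subset (by rwa [Set.inter_comm]))
  · subst hj
    exact absurd (subset_B hi) ((hA i).not_subset hp)
  · have hempty : A i ∩ B j = ∅ := Set.subset_empty_iff.1 fun x hx =>
      (hBd j j' hj).subset ⟨hx.2, subset_B hi hx.1⟩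
    exact absurd (fun x hx => (hempty.subset hx).elim) hp
end
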